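/- Let n ≥ 1, 0 ≤ ϱ ≤ 1, 0 ≤ δ < 1, m ∈ ℝ, and a ∈ S^m_{ϱ,δ}. If m < −(n/2)(1−ϱ) − (n/2)max{δ−ϱ, 0}, then there is a constant C such that ‖T_a u‖_{L^1(ℝⁿ)} ≤ C ‖u‖_{L^1(ℝⁿ)} for all Schwartz functions u. -/

import Mathlib

open MeasureTheory Real
open scoped ENNReal NNReal InnerProductSpace BigOperators

noncomputable section

/-- `ℝⁿ` with its Euclidean structure. -/
abbrev Rn (n : ℕ) : Type := EuclideanSpace ℝ (Fin n)

/-- The Fourier transform `û(ξ) = ∫ e^{-i⟨x,ξ⟩} u(x) dx`. -/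
def ft {n : ℕ} (u : Rn n → ℂ) (ξ : Rn n) : ℂ :=
  ∫ x : Rn n, Complex.exp (-(Complex.I * ((⟪x, ξ⟫_ℝ : ℝ) : ℂ))) * u x

/-- The pseudo-differential operator `T_a u(x) = ∫ e^{i⟨x,ξ⟩} a(x,ξ) û(ξ) dξ`. -/
def pdo {n : ℕ} (a : Rn n → Rn n → ℂ) (u : Rn n → ℂ) (x : Rn n) : ℂ :=
  ∫ ξ : Rn n, Complex.exp (Complex.I * ((⟪x, ξ⟫_ℝ : ℝ) : ℂ)) * a x ξ * ft u ξ

/-- The dual operator `T_a^* u(x) = ∫∫ e^{i⟨x-y,ξ⟩} a(y,ξ) dξ u(y) dy`. -/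
def pdoDual {n : ℕ} (a : Rn n → Rn n → ℂ) (u : Rn n → ℂ) (x : Rn n) : ℂ :=
  ∫ y : Rn n,
    (∫ ξ : Rn n, Complex.exp (Complex.I * ((⟪x - y, ξ⟫_ℝ : ℝ) : ℂ)) * a y ξ) * u y

/-- The Hörmander symbol class `S^m_{ϱ,δ}`: `a` is smooth and
`|∂^β_x ∂^α_ξ a(x,ξ)| ≤ C_{α,β} (1+|ξ|²)^{(m-ϱ|α|+δ|β|)/2}`. -/
def HormClass {n : ℕ} (m ϱ δ : ℝ) (a : Rn n → Rn n → ℂ) : Prop :=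
  ContDiff ℝ (⊤ : ℕ∞) (Function.uncurry a) ∧
  ∀ k l : ℕ, ∃ C : ℝ, 0 < C ∧ ∀ x ξ : Rn n,
    ‖iteratedFDeriv ℝ l (fun y : Rn n => iteratedFDeriv ℝ k (fun η : Rn n => a y η) ξ) x‖ ≤
      C * (1 + ‖ξ‖ ^ 2) ^ ((m - ϱ * k + δ * l) / 2)

/-- The rough Hörmander class `L^∞S^m_ϱ`: `a(x,ξ)` is smooth in `ξ`, bounded measurable in `x`,
and `‖∂^α_ξ a(·,ξ)‖_{L^∞} ≤ C_α (1+|ξ|²)^{(m-ϱ|α|)/2}`. -/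
def RoughClass {n : ℕ} (m ϱ : ℝ) (a : Rn n → Rn n → ℂ) : Prop :=
  (∀ x : Rn n, ContDiff ℝ (⊤ : ℕ∞) (a x)) ∧
  (∀ ξ : Rn n, Measurable fun x : Rn n => a x ξ) ∧
  ∀ k : ℕ, ∃ C : ℝ, 0 < C ∧ ∀ ξ : Rn n, ∀ᵐ x : Rn n ∂volume,
    ‖iteratedFDeriv ℝ k (a x) ξ‖ ≤ C * (1 + ‖ξ‖ ^ 2) ^ ((m - ϱ * k) / 2)

/-- The axis-parallel cube centered at `x₀` with side length `l`. -/
def cube {n : ℕ} (x₀ : Rn n) (l : ℝ) : Set (Rn n) :=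
  {y | ∀ i, |y i - x₀ i| ≤ l / 2}

/-- The Hardy–Littlewood maximal function over axis-parallel cubes. -/
def mHL {n : ℕ} {E : Type*} [NormedAddCommGroup E] (u : Rn n → E) (x : Rn n) : ℝ≥0∞ :=
  ⨆ (x₀ : Rn n) (l : ℝ) (_ : 0 < l) (_ : x ∈ cube x₀ l),
    (∫⁻ y in cube x₀ l, (‖u y‖₊ : ℝ≥0∞)) / ENNReal.ofReal (l ^ n)

/-- The Fefferman–Stein sharp maximal function over axis-parallel cubes. -/
def mSharp {n : ℕ} (u : Rn n → ℂ) (x : Rn n) : ℝ≥0∞ :=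
  ⨆ (x₀ : Rn n) (l : ℝ) (_ : 0 < l) (_ : x ∈ cube x₀ l),
    ⨅ c : ℂ, (∫⁻ y in cube x₀ l, (‖u y - c‖₊ : ℝ≥0∞)) / ENNReal.ofReal (l ^ n)

/-- The Muckenhoupt `A₁` condition: `Mω ≤ C ω` a.e. -/
def IsA1 {n : ℕ} (ω : Rn n → ℝ) : Prop :=
  (∀ x, 0 ≤ ω x) ∧ LocallyIntegrable ω volume ∧
  ∃ C : ℝ, 0 < C ∧ ∀ᵐ x : Rn n ∂volume, mHL ω x ≤ ENNReal.ofReal (C * ω x)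

/-- The Muckenhoupt `A_p` condition for `1 < p < ∞`. -/
def IsAp {n : ℕ} (p : ℝ) (ω : Rn n → ℝ) : Prop :=
  (∀ x, 0 ≤ ω x) ∧ LocallyIntegrable ω volume ∧
  ∃ C : ℝ, 0 < C ∧ ∀ (x₀ : Rn n) (l : ℝ), 0 < l →
    ((∫⁻ y in cube x₀ l, ENNReal.ofReal (ω y)) / ENNReal.ofReal (l ^ n)) *
      (((∫⁻ y in cube x₀ l, ENNReal.ofReal (ω y ^ (1 / (1 - p)))) /
          ENNReal.ofReal (l ^ n)) ^ (p - 1))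
      ≤ ENNReal.ofReal C

/-- The weighted measure `ω(s) = ∫_s ω dx`. -/
def wMeas {n : ℕ} (ω : Rn n → ℝ) (s : Set (Rn n)) : ℝ≥0∞ :=
  ∫⁻ x in s, ENNReal.ofReal (ω x)

/-- The weighted `L¹` norm `∫ |u| ω dx`. -/
def wL1 {n : ℕ} (ω : Rn n → ℝ) (u : Rn n → ℂ) : ℝ≥0∞ :=
  ∫⁻ x : Rn n, (‖u x‖₊ : ℝ≥0∞) * ENNReal.ofReal (ω x)

/-- The weighted `L^p` norm `(∫ |u|^p ω dx)^{1/p}`. -/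
def wLp {n : ℕ} (p : ℝ) (ω : Rn n → ℝ) (u : Rn n → ℂ) : ℝ≥0∞ :=
  (∫⁻ x : Rn n, (‖u x‖₊ : ℝ≥0∞) ^ p * ENNReal.ofReal (ω x)) ^ (1 / p)

/-- A Littlewood–Paley cut-off: `ψ ∈ C_c^∞`, `0 ≤ ψ ≤ 1`, supported in the annulus
`{C₀⁻¹ ≤ |ξ| ≤ 2C₀}`. -/
def LPcut {n : ℕ} (C₀ : ℝ) (ψ : Rn n → ℝ) : Prop :=
  ContDiff ℝ (⊤ : ℕ∞) ψ ∧ HasCompactSupport ψ ∧ (∀ ξ, 0 ≤ ψ ξ) ∧ (∀ ξ, ψ ξ ≤ 1) ∧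
  tsupport ψ ⊆ {ξ : Rn n | C₀⁻¹ ≤ ‖ξ‖ ∧ ‖ξ‖ ≤ 2 * C₀}

/-- `K_j(x,y) = (2π)^{-n} ∫ e^{i⟨x-y,ξ⟩} a(x,ξ) ψ(2^{-j}ξ) dξ`. -/
def Kj {n : ℕ} (a : Rn n → Rn n → ℂ) (ψ : Rn n → ℝ) (j : ℕ) (x y : Rn n) : ℂ :=
  ((((2 * π) ^ n)⁻¹ : ℝ) : ℂ) *
    ∫ ξ : Rn n, Complex.exp (Complex.I * ((⟪x - y, ξ⟫_ℝ : ℝ) : ℂ)) * a x ξ *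
      ((ψ ((((2 : ℝ) ^ j)⁻¹) • ξ) : ℝ) : ℂ)

/-- `K_j^*(x,y) = (2π)^{-n} ∫ e^{i⟨x-y,ξ⟩} a(y,ξ) ψ(2^{-j}ξ) dξ`. -/
def KjStar {n : ℕ} (a : Rn n → Rn n → ℂ) (ψ : Rn n → ℝ) (j : ℕ) (x y : Rn n) : ℂ :=
  ((((2 * π) ^ n)⁻¹ : ℝ) : ℂ) *
    ∫ ξ : Rn n, Complex.exp (Complex.I * ((⟪x - y, ξ⟫_ℝ : ℝ) : ℂ)) * a y ξ *
      ((ψ ((((2 : ℝ) ^ j)⁻¹) • ξ) : ℝ) : ℂ)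

/-- `T_j u(x) = ∫ K_j(x,y) u(y) dy`. -/
def Tj {n : ℕ} (a : Rn n → Rn n → ℂ) (ψ : Rn n → ℝ) (j : ℕ) (u : Rn n → ℂ) (x : Rn n) : ℂ :=
  ∫ y : Rn n, Kj a ψ j x y * u y

/-- `T_j^* u(x) = ∫ K_j^*(x,y) u(y) dy`. -/
def TjStar {n : ℕ} (a : Rn n → Rn n → ℂ) (ψ : Rn n → ℝ) (j : ℕ) (u : Rn n → ℂ) (x : Rn n) : ℂ :=
  ∫ y : Rn n, KjStar a ψ j x y * u y

/-- The Fourier integral operator `T_{a,φ} u(x) = ∫ e^{iφ(x,ξ)} a(x,ξ) û(ξ) dξ`. -/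
def fio {n : ℕ} (a : Rn n → Rn n → ℂ) (φ : Rn n → Rn n → ℝ) (u : Rn n → ℂ) (x : Rn n) : ℂ :=
  ∫ ξ : Rn n, Complex.exp (Complex.I * ((φ x ξ : ℝ) : ℂ)) * a x ξ * ft u ξ

/-- The dual FIO `T^*_{a,φ} u(x) = ∫∫ e^{i(φ(y,ξ)-⟨x,ξ⟩)} a(y,ξ) dξ u(y) dy`. -/
def fioDual {n : ℕ} (a : Rn n → Rn n → ℂ) (φ : Rn n → Rn n → ℝ) (u : Rn n → ℂ) (x : Rn n) : ℂ :=
  ∫ y : Rn n,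
    (∫ ξ : Rn n, Complex.exp (Complex.I * ((φ y ξ - ⟪x, ξ⟫_ℝ : ℝ) : ℂ)) * a y ξ) * u y

/-- The phase class `Φ¹`: smooth on `ℝⁿ × (ℝⁿ∖{0})`, positively homogeneous of degree 1 in `ξ`,
with `sup |ξ|^{-1+|α|} |∂^α_ξ ∂^β_x φ| ≤ C_{α,β}` for `|α|+|β| ≥ 1`. -/
def Phi1 {n : ℕ} (φ : Rn n → Rn n → ℝ) : Prop :=
  ContDiffOn ℝ (⊤ : ℕ∞) (Function.uncurry φ) {p : Rn n × Rn n | p.2 ≠ 0} ∧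
  (∀ x : Rn n, ∀ ξ : Rn n, ξ ≠ 0 → ∀ t : ℝ, 0 < t → φ x (t • ξ) = t * φ x ξ) ∧
  ∀ k l : ℕ, 1 ≤ k + l → ∃ C : ℝ, 0 < C ∧ ∀ x ξ : Rn n, ξ ≠ 0 →
    ‖ξ‖ ^ ((k : ℝ) - 1) *
        ‖iteratedFDeriv ℝ k (fun η : Rn n => iteratedFDeriv ℝ l (fun y : Rn n => φ y η) x) ξ‖
      ≤ C

/-- The rough phase class `L^∞Φ¹`: positively homogeneous of degree 1 in `ξ`, smooth in `ξ` away
from the origin, bounded measurable in `x`, with `sup |ξ|^{-1+|α|} ‖∂^α_ξ φ(·,ξ)‖_{L^∞} ≤ C_α`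
for `|α| ≥ 1`. -/
def LinfPhi1 {n : ℕ} (φ : Rn n → Rn n → ℝ) : Prop :=
  (∀ x : Rn n, ContDiffOn ℝ (⊤ : ℕ∞) (φ x) {ξ : Rn n | ξ ≠ 0}) ∧
  (∀ ξ : Rn n, Measurable fun x : Rn n => φ x ξ) ∧
  (∀ ξ : Rn n, ∃ C : ℝ, ∀ x : Rn n, |φ x ξ| ≤ C) ∧
  (∀ x : Rn n, ∀ ξ : Rn n, ξ ≠ 0 → ∀ t : ℝ, 0 < t → φ x (t • ξ) = t * φ x ξ) ∧
  ∀ k : ℕ, 1 ≤ k → ∃ C : ℝ, 0 < C ∧ ∀ ξ : Rn n, ξ ≠ 0 → ∀ᵐ x : Rn n ∂volume,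
    ‖ξ‖ ^ ((k : ℝ) - 1) * ‖iteratedFDeriv ℝ k (φ x) ξ‖ ≤ C

/-- The partial derivative of a symbol in the `i`-th space variable. -/
def symDx {n : ℕ} (i : Fin n) (f : Rn n → Rn n → ℂ) : Rn n → Rn n → ℂ :=
  fun z ξ => fderiv ℝ (fun y => f y ξ) z (EuclideanSpace.single i 1)

/-- The partial derivative of a symbol in the `i`-th frequency variable. -/
def symDxi {n : ℕ} (i : Fin n) (f : Rn n → Rn n → ℂ) : Rn n → Rn n → ℂ :=
  fun z ξ => fderiv ℝ (f z) ξ (EuclideanSpace.single i 1)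

/-- The `i`-th partial derivative. -/
def partialD {n : ℕ} (i : Fin n) (φ : Rn n → ℂ) : Rn n → ℂ :=
  fun ξ => fderiv ℝ φ ξ (EuclideanSpace.single i 1)

/-- The iterated space derivative of a symbol along a word of coordinates; the head of the word
is the outermost derivative. -/
def symDxWord {n : ℕ} (w : List (Fin n)) (f : Rn n → Rn n → ℂ) : Rn n → Rn n → ℂ :=
  w.foldr symDx f

/-- Joint smoothness of a symbol. -/
def SymSmooth {n : ℕ} (f : Rn n → Rn n → ℂ) : Prop :=
  ContDiff ℝ (⊤ : ℕ∞) (Function.uncurry f)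

section SymbolCalculus

variable {n : ℕ}

theorem contDiff_partialD {φ : Rn n → ℂ} (hφ : ContDiff ℝ (⊤ : ℕ∞) φ) (i : Fin n) :
    ContDiff ℝ (⊤ : ℕ∞) (partialD i φ) :=
  (hφ.fderiv_right (by simp)).clm_apply contDiff_const

theorem SymSmooth.left {f : Rn n → Rn n → ℂ} (hf : SymSmooth f) (ξ : Rn n) :
    ContDiff ℝ (⊤ : ℕ∞) (fun y => f y ξ) :=
  ContDiff.comp (g := Function.uncurry f) hf (contDiff_id.prodMk contDiff_const)

theorem SymSmooth.right {f : Rn n → Rn n → ℂ} (hf : SymSmooth f) (z : Rn n) :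
    ContDiff ℝ (⊤ : ℕ∞) (f z) :=
  ContDiff.comp (g := Function.uncurry f) hf (contDiff_const.prodMk contDiff_id)

theorem SymSmooth.symDx {f : Rn n → Rn n → ℂ} (hf : SymSmooth f) (i : Fin n) :
    SymSmooth (symDx i f) := by
  refine ContDiff.fderiv_apply (m := (⊤ : ℕ∞)) (f := fun (p : Rn n × Rn n) y => f y p.2)
    (g := Prod.fst) (k := fun _ => EuclideanSpace.single i 1) ?_ contDiff_fst contDiff_const
    (by simp)
  exact ContDiff.comp (g := Function.uncurry f)
    (f := fun q : (Rn n × Rn n) × Rn n => (q.2, q.1.2)) hf (by fun_prop)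

theorem SymSmooth.symDxi {f : Rn n → Rn n → ℂ} (hf : SymSmooth f) (i : Fin n) :
    SymSmooth (symDxi i f) := by
  refine ContDiff.fderiv_apply (m := (⊤ : ℕ∞)) (f := fun (p : Rn n × Rn n) y => f p.1 y)
    (g := Prod.snd) (k := fun _ => EuclideanSpace.single i 1) ?_ contDiff_snd contDiff_const
    (by simp)
  exact ContDiff.comp (g := Function.uncurry f)
    (f := fun q : (Rn n × Rn n) × Rn n => (q.1.1, q.2)) hf (by fun_prop)

theorem SymSmooth.symDxWord {f : Rn n → Rn n → ℂ} (hf : SymSmooth f) (w : List (Fin n)) :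
    SymSmooth (symDxWord w f) := by
  induction w with
  | nil => exact hf
  | cons i w ih => exact ih.symDx i

theorem SymSmooth.symDxi_iterate {f : Rn n → Rn n → ℂ} (hf : SymSmooth f) (i : Fin n) (k : ℕ) :
    SymSmooth ((_root_.symDxi i)^[k] f) := by
  induction k generalizing f with
  | zero => exact hf
  | succ k ih => exact ih (hf.symDxi i)

theorem SymSmooth.contDiff_iteratedFDeriv {f : Rn n → Rn n → ℂ} (hf : SymSmooth f) (k : ℕ)
    (ξ : Rn n) : ContDiff ℝ (⊤ : ℕ∞) (fun y => iteratedFDeriv ℝ k (f y) ξ) := by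
  have key : ∀ y, iteratedFDeriv ℝ k (f y) ξ =
      ContinuousMultilinearMap.compContinuousLinearMapL
        (fun _ : Fin k => ContinuousLinearMap.inr ℝ (Rn n) (Rn n))
        (iteratedFDeriv ℝ k (Function.uncurry f) (y, ξ)) := by
    intro y
    have h1 : f y = (fun p => Function.uncurry f ((y, 0) + p)) ∘
        (ContinuousLinearMap.inr ℝ (Rn n) (Rn n)) := by
      ext η; simp
    have h2 : ContDiff ℝ (⊤ : ℕ∞) (fun p => Function.uncurry f ((y, 0) + p)) :=
      ContDiff.comp (g := Function.uncurry f) hf (by fun_prop)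
    rw [h1, ContinuousLinearMap.iteratedFDeriv_comp_right _ h2 ξ (by exact_mod_cast le_top),
      iteratedFDeriv_comp_add_left]
    simp
  simp_rw [key]
  refine (ContinuousLinearMap.contDiff _).comp ?_
  have := ContDiff.iteratedFDeriv_right (m := (⊤ : ℕ∞)) (i := k) hf le_rfl
  exact this.comp (by fun_prop)

theorem symDxi_iterate_apply {f : Rn n → Rn n → ℂ} (hf : SymSmooth f) (i : Fin n) (k : ℕ)
    (z ξ : Rn n) : (symDxi i)^[k] f z ξ =
      iteratedFDeriv ℝ k (f z) ξ (fun _ => EuclideanSpace.single i 1) := by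
  induction k generalizing ξ with
  | zero => simp
  | succ k ih =>
    rw [Function.iterate_succ_apply', iteratedFDeriv_succ_apply_left]
    have h : (symDxi i)^[k] f z = fun η => iteratedFDeriv ℝ k (f z) η
        (fun _ => EuclideanSpace.single i 1) := funext ih
    rw [symDxi, h, fderiv_continuousMultilinear_apply_const_apply]
    · rfl
    · exact ((hf.right z).differentiable_iteratedFDeriv (by exact_mod_cast WithTop.coe_lt_top _)) _

theorem symDxWord_apply {f : Rn n → Rn n → ℂ} (hf : SymSmooth f) (w : List (Fin n))
    (z ξ : Rn n) : symDxWord w f z ξ =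
      iteratedFDeriv ℝ w.length (fun y => f y ξ) z
        (fun j => EuclideanSpace.single (w.get j) 1) := by
  induction w generalizing z with
  | nil => simp [symDxWord]
  | cons i w ih =>
    simp only [List.length_cons]
    rw [iteratedFDeriv_succ_apply_left]
    have h : (fun y => symDxWord w f y ξ) = fun y => iteratedFDeriv ℝ w.length (fun y => f y ξ) y
        (fun j => EuclideanSpace.single (w.get j) 1) := funext ih
    change symDx i (symDxWord w f) z ξ = _
    rw [symDx, h, fderiv_continuousMultilinear_apply_const_apply]
    · rfl
    · exact ((hf.left ξ).differentiable_iteratedFDeriv (by exact_mod_cast WithTop.coe_lt_top _)) _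

theorem norm_symDxWord_symDxi_iterate_le {f : Rn n → Rn n → ℂ} (hf : SymSmooth f)
    (w : List (Fin n)) (i : Fin n) (k : ℕ) (z ξ : Rn n) :
    ‖symDxWord w ((symDxi i)^[k] f) z ξ‖ ≤
      ‖iteratedFDeriv ℝ w.length (fun y => iteratedFDeriv ℝ k (f y) ξ) z‖ := by
  rw [symDxWord_apply (hf.symDxi_iterate i k)]
  refine (ContinuousMultilinearMap.le_opNorm _ _).trans ?_
  simp only [PiLp.norm_single, norm_one, Finset.prod_const_one, mul_one]
  have h : (fun y => (symDxi i)^[k] f y ξ) =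
      (ContinuousMultilinearMap.apply ℝ (fun _ : Fin k => Rn n) ℂ
        (fun _ => EuclideanSpace.single i 1)) ∘ (fun y => iteratedFDeriv ℝ k (f y) ξ) := by
    ext y
    rw [symDxi_iterate_apply hf]
    rfl
  rw [h]
  refine (ContinuousLinearMap.norm_iteratedFDeriv_comp_left _
    (hf.contDiff_iteratedFDeriv k ξ).contDiffAt (by exact_mod_cast le_top)).trans ?_
  refine mul_le_of_le_one_left (norm_nonneg _) ?_
  refine ContinuousLinearMap.opNorm_le_bound _ zero_le_one fun M => ?_
  refine (ContinuousMultilinearMap.le_opNorm M _).trans ?_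
  simp

theorem symDxWord_add {f g : Rn n → Rn n → ℂ} (hf : SymSmooth f) (hg : SymSmooth g)
    (w : List (Fin n)) : symDxWord w (f + g) = symDxWord w f + symDxWord w g := by
  induction w with
  | nil => rfl
  | cons i w ih =>
    change symDx i (symDxWord w (f + g)) = symDx i (symDxWord w f) + symDx i (symDxWord w g)
    rw [ih]
    ext z ξ
    have h1 : DifferentiableAt ℝ (fun y => symDxWord w f y ξ) z :=
      ((hf.symDxWord w).left ξ).differentiable (by simp) z
    have h2 : DifferentiableAt ℝ (fun y => symDxWord w g y ξ) z :=
      ((hg.symDxWord w).left ξ).differentiable (by simp) z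
    simp only [symDx, Pi.add_apply]
    rw [fderiv_fun_add h1 h2]
    rfl

theorem symDxi_iterate_add {f g : Rn n → Rn n → ℂ} (hf : SymSmooth f) (hg : SymSmooth g)
    (i : Fin n) (k : ℕ) :
    (symDxi i)^[k] (f + g) = (symDxi i)^[k] f + (symDxi i)^[k] g := by
  induction k generalizing f g with
  | zero => rfl
  | succ k ih =>
    rw [Function.iterate_succ_apply, Function.iterate_succ_apply, Function.iterate_succ_apply,
      ← ih (hf.symDxi i) (hg.symDxi i)]
    congr 1
    ext z ξ
    have h1 : DifferentiableAt ℝ (f z) ξ := (hf.right z).differentiable (by simp) ξ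
    have h2 : DifferentiableAt ℝ (g z) ξ := (hg.right z).differentiable (by simp) ξ
    simp only [symDxi, Pi.add_apply]
    rw [fderiv_add h1 h2]
    rfl

/-- The product of a symbol and a Fourier multiplier. -/
def symCut (f : Rn n → Rn n → ℂ) (ψ : Rn n → ℂ) : Rn n → Rn n → ℂ := fun z ξ => f z ξ * ψ ξ

theorem SymSmooth.symCut {f : Rn n → Rn n → ℂ} (hf : SymSmooth f) {ψ : Rn n → ℂ}
    (hψ : ContDiff ℝ (⊤ : ℕ∞) ψ) : SymSmooth (symCut f ψ) :=
  ContDiff.mul (f := Function.uncurry f) (g := fun p : Rn n × Rn n => ψ p.2) hf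
    (hψ.comp contDiff_snd)

theorem symDxWord_symCut {f : Rn n → Rn n → ℂ} (hf : SymSmooth f) (ψ : Rn n → ℂ)
    (w : List (Fin n)) : symDxWord w (symCut f ψ) = symCut (symDxWord w f) ψ := by
  induction w with
  | nil => rfl
  | cons i w ih =>
    change symDx i (symDxWord w (symCut f ψ)) = symCut (symDx i (symDxWord w f)) ψ
    rw [ih]
    ext z ξ
    have h1 : DifferentiableAt ℝ (fun y => symDxWord w f y ξ) z :=
      ((hf.symDxWord w).left ξ).differentiable (by simp) z
    simp only [symDx, symCut]
    rw [fderiv_mul_const h1]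
    simp [mul_comm]

theorem symDxi_symCut {f : Rn n → Rn n → ℂ} (hf : SymSmooth f) {ψ : Rn n → ℂ}
    (hψ : ContDiff ℝ (⊤ : ℕ∞) ψ) (i : Fin n) :
    symDxi i (symCut f ψ) = symCut (symDxi i f) ψ +
      symCut f (partialD i ψ) := by
  ext z ξ
  have h1 : DifferentiableAt ℝ (f z) ξ := (hf.right z).differentiable (by simp) ξ
  have h2 : DifferentiableAt ℝ ψ ξ := hψ.differentiable (by simp) ξ
  change fderiv ℝ (fun η => f z η * ψ η) ξ _ = _
  rw [fderiv_fun_mul h1 h2]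
  simp [symDxi, partialD, symCut, mul_comm, add_comm]

/-- Leibniz estimate for the mixed derivatives of the product of a symbol and a multiplier. -/
theorem norm_symDxWord_symDxi_iterate_symCut_le (w : List (Fin n)) (i : Fin n) (z ξ : Rn n)
    (σ : ℝ) (k : ℕ) :
    ∀ (f : Rn n → Rn n → ℂ) (ψ : Rn n → ℂ) (A B : ℝ), 0 ≤ A → SymSmooth f →
      ContDiff ℝ (⊤ : ℕ∞) ψ →
      (∀ l ≤ k, ‖symDxWord w ((symDxi i)^[l] f) z ξ‖ ≤ A * σ ^ l) →
      (∀ l ≤ k, ‖(partialD i)^[l] ψ ξ‖ ≤ B * σ ^ l) →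
      0 ≤ σ → ‖symDxWord w ((symDxi i)^[k] (symCut f ψ)) z ξ‖ ≤ 2 ^ k * (A * B * σ ^ k) := by
  induction k with
  | zero =>
    intro f ψ A B hA hf hψ h1 h2 hσ
    have h1 := h1 0 le_rfl
    have h2 := h2 0 le_rfl
    simp only [Function.iterate_zero, id_eq, pow_zero, mul_one, one_mul] at h1 h2 ⊢
    rw [symDxWord_symCut hf]
    simp only [symCut, norm_mul]
    gcongr
  | succ k ih =>
    intro f ψ A B hA hf hψ h1 h2 hσ
    have hψ' : ContDiff ℝ (⊤ : ℕ∞) (partialD i ψ) := contDiff_partialD hψ i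
    have hs1 := (hf.symDxi i).symCut hψ
    have hs2 := hf.symCut hψ'
    rw [Function.iterate_succ_apply, symDxi_symCut hf hψ, symDxi_iterate_add hs1 hs2,
      symDxWord_add (hs1.symDxi_iterate i k) (hs2.symDxi_iterate i k)]
    have e1 := ih (symDxi i f) ψ (A * σ) B (by positivity) (hf.symDxi i) hψ
      (fun l hl => by
        have := h1 (l + 1) (by omega)
        rw [Function.iterate_succ_apply] at this
        rw [mul_assoc, ← pow_succ']
        exact this)
      (fun l hl => h2 l (by omega)) hσ
    have e2 := ih f _ A (B * σ) hA hf hψ' (fun l hl => h1 l (by omega))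
      (fun l hl => by
        have := h2 (l + 1) (by omega)
        rw [Function.iterate_succ_apply] at this
        rw [mul_assoc, ← pow_succ']
        exact this) hσ
    refine (norm_add_le _ _).trans ((add_le_add e1 e2).trans (le_of_eq ?_))
    ring

theorem symDxWord_eq_zero {f : Rn n → Rn n → ℂ} {ξ : Rn n} (h : ∀ z, f z ξ = 0)
    (w : List (Fin n)) (z : Rn n) : symDxWord w f z ξ = 0 := by
  induction w generalizing z with
  | nil => exact h z
  | cons i w ih =>
    change fderiv ℝ (fun y => symDxWord w f y ξ) z _ = 0
    rw [funext ih]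
    simp

theorem symDxi_iterate_eq_zero {f : Rn n → Rn n → ℂ} {ρ : ℝ}
    (h : ∀ z ξ, ρ < ‖ξ‖ → f z ξ = 0) (i : Fin n) (k : ℕ) :
    ∀ z ξ, ρ < ‖ξ‖ → (symDxi i)^[k] f z ξ = 0 := by
  induction k generalizing f with
  | zero => exact h
  | succ k ih =>
    refine ih fun z ξ hξ => ?_
    have : f z =ᶠ[nhds ξ] fun _ => 0 := by
      filter_upwards [(isOpen_lt continuous_const continuous_norm).mem_nhds hξ] with η hη
      exact h z η hη
    simp [symDxi, this.fderiv_eq]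

end SymbolCalculus

/-- The cube of side `r` with smallest vertex `x`. -/
def cornerBox {n : ℕ} (x : Rn n) (r : ℝ) : Set (Rn n) :=
  {z | ∀ i, z i ∈ Set.Icc (x i) (x i + r)}

theorem enorm_le_lintegral_Icc {g g' : ℝ → ℂ} (hg : ∀ t, HasDerivAt g (g' t) t)
    (hg' : Continuous g') (r : ℝ) (a : ℝ) :
    ENNReal.ofReal r * ‖g a‖ₑ ≤
      ∫⁻ t in Set.Icc a (a + r), (‖g t‖ₑ + ENNReal.ofReal r * ‖g' t‖ₑ) := by
  have hgc : Continuous g := continuous_iff_continuousAt.2 fun t => (hg t).continuousAt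
  have hvol : volume (Set.Icc a (a + r)) = ENNReal.ofReal r := by simp
  have key : ∀ t ∈ Set.Icc a (a + r), ‖g a‖ₑ ≤ ‖g t‖ₑ + ∫⁻ s in Set.Icc a (a + r), ‖g' s‖ₑ := by
    intro t ht
    have h1 : ∫ s in a..t, g' s = g t - g a :=
      intervalIntegral.integral_eq_sub_of_hasDerivAt (fun s _ => hg s)
        (hg'.intervalIntegrable _ _)
    have h2 : g a = g t - ∫ s in a..t, g' s := by rw [h1]; ring
    calc ‖g a‖ₑ = ‖g t - ∫ s in a..t, g' s‖ₑ := by rw [← h2]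
      _ ≤ ‖g t‖ₑ + ‖∫ s in a..t, g' s‖ₑ := enorm_sub_le
      _ ≤ ‖g t‖ₑ + ∫⁻ s in Set.Icc a (a + r), ‖g' s‖ₑ := by
        gcongr
        rw [intervalIntegral.integral_of_le ht.1]
        refine (enorm_integral_le_lintegral_enorm _).trans ?_
        exact lintegral_mono_set fun s hs => ⟨hs.1.le, hs.2.trans ht.2⟩
  calc ENNReal.ofReal r * ‖g a‖ₑ = ∫⁻ _ in Set.Icc a (a + r), ‖g a‖ₑ := by
        rw [setLIntegral_const, hvol, mul_comm]
    _ ≤ ∫⁻ t in Set.Icc a (a + r), (‖g t‖ₑ + ∫⁻ s in Set.Icc a (a + r), ‖g' s‖ₑ) :=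
        setLIntegral_mono' measurableSet_Icc key
    _ = _ := by
        rw [lintegral_add_left hgc.measurable.enorm, lintegral_add_left hgc.measurable.enorm,
          setLIntegral_const, hvol, lintegral_const_mul _ hg'.measurable.enorm, mul_comm]

theorem measurableSet_cornerBox {n : ℕ} (x : Rn n) (r : ℝ) : MeasurableSet (cornerBox x r) := by
  have : cornerBox x r = ⋂ i, (fun z : Rn n => z i) ⁻¹' Set.Icc (x i) (x i + r) := by
    ext z; simp [cornerBox]
  rw [this]
  exact MeasurableSet.iInter fun i => measurableSet_Icc.preimage (by fun_prop)

/-- A Sobolev inequality with mixed derivatives: the value at the corner of a cube of a function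
whose partial derivatives are listed by `F` is controlled by their scaled averages. -/
theorem enorm_le_lintegral_cornerBox {n : ℕ} {r : ℝ} (hr : 0 < r)
    (F : List (Fin n) → Rn n → ℂ) (hc : ∀ w, Continuous (F w))
    (hd : ∀ w i x, HasLineDerivAt ℝ (F w) (F (i :: w) x) x (EuclideanSpace.single i 1))
    (G : Rn n → ℝ≥0∞) (hGm : Measurable G)
    (hG : ∀ w : List (Fin n), w.length ≤ n → ∀ y,
      ENNReal.ofReal r ^ w.length * ‖F w y‖ₑ ≤ G y) (x₀ : Rn n) :
    ‖F [] x₀‖ₑ ≤ (2 / ENNReal.ofReal r) ^ n * ∫⁻ z in cornerBox x₀ r, G z := by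
  set ρ := ENNReal.ofReal r with hρ
  have hρ0 : ρ ≠ 0 := by simpa [hρ] using hr
  have hρt : ρ ≠ ⊤ := ENNReal.ofReal_ne_top
  let μ : Fin n → Measure ℝ := fun i => volume.restrict (Set.Icc (x₀ i) (x₀ i + r))
  let H : (Fin n → ℝ) → ℝ≥0∞ := fun x => G (WithLp.toLp 2 x)
  have hHm : Measurable H := hGm.comp (by fun_prop)
  have claim : ∀ s : Finset (Fin n), ∀ w : List (Fin n), w.length + s.card ≤ n →
      ∀ x : Fin n → ℝ, (∀ i ∈ s, x i = x₀ i) →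
      ρ ^ w.length * ‖F w (WithLp.toLp 2 x)‖ₑ ≤ (2 / ρ) ^ s.card * (∫⋯∫⁻_s, H ∂μ) x := by
    intro s
    induction s using Finset.induction_on with
    | empty =>
      intro w hw x _
      simpa using hG w (by simpa using hw) (WithLp.toLp 2 x)
    | insert i s hi ih =>
      intro w hw x hx
      rw [Finset.card_insert_of_notMem hi] at hw ⊢
      have hxi : x i = x₀ i := hx i (Finset.mem_insert_self _ _)
      have hline : ∀ w t, HasDerivAt (fun t : ℝ => F w (WithLp.toLp 2 (Function.update x i t)))
          (F (i :: w) (WithLp.toLp 2 (Function.update x i t))) t := by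
        intro w t
        have h := hd w i (WithLp.toLp 2 (Function.update x i t))
        have h' : HasDerivAt (fun s : ℝ => F w (WithLp.toLp 2 (Function.update x i t) +
          s • EuclideanSpace.single i (1 : ℝ))) (F (i :: w) (WithLp.toLp 2 (Function.update x i t)))
            (t - t) := by rw [sub_self]; exact h
        have h2 := h'.comp_sub_const t t
        refine h2.congr_of_eventuallyEq (Filter.Eventually.of_forall fun s => ?_)
        simp only
        congr 1
        ext j
        by_cases hj : j = i
        · subst hj; simp
        · simp [hj]
      have hcu : ∀ w, Continuous
          (fun t : ℝ => F w (WithLp.toLp 2 (Function.update x i t))) := fun w =>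
        (hc w).comp (by fun_prop)
      have h1 := enorm_le_lintegral_Icc (hline w) (hcu (i :: w)) r (x i)
      rw [Function.update_eq_self, ← hρ] at h1
      have h2 : ∀ t, ρ ^ w.length * (‖F w (WithLp.toLp 2 (Function.update x i t))‖ₑ +
          ρ * ‖F (i :: w) (WithLp.toLp 2 (Function.update x i t))‖ₑ) ≤
          2 * ((2 / ρ) ^ s.card * (∫⋯∫⁻_s, H ∂μ) (Function.update x i t)) := by
        intro t
        have hcond : ∀ j ∈ s, Function.update x i t j = x₀ j := by
          intro j hj
          have hne : j ≠ i := fun h => hi (h ▸ hj)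
          rw [Function.update_of_ne hne]
          exact hx j (Finset.mem_insert_of_mem hj)
        have e1 := ih w (by omega) _ hcond
        have e2 := ih (i :: w) (by simp only [List.length_cons]; omega) _ hcond
        rw [List.length_cons, pow_succ, mul_assoc] at e2
        rw [mul_add, two_mul]
        exact add_le_add e1 e2
      have hml : Measurable fun t => (∫⋯∫⁻_s, H ∂μ) (Function.update x i t) :=
        (hHm.lmarginal μ).comp (measurable_update x)
      rw [lmarginal_insert _ hHm hi]
      have h3 : ρ * (ρ ^ w.length * ‖F w (WithLp.toLp 2 x)‖ₑ) ≤
          2 * (2 / ρ) ^ s.card * ∫⁻ t, (∫⋯∫⁻_s, H ∂μ) (Function.update x i t) ∂μ i := by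
        calc ρ * (ρ ^ w.length * ‖F w (WithLp.toLp 2 x)‖ₑ)
            = ρ ^ w.length * (ρ * ‖F w (WithLp.toLp 2 x)‖ₑ) := by ring
          _ ≤ ρ ^ w.length * _ := mul_le_mul' le_rfl h1
          _ = ∫⁻ t in Set.Icc (x i) (x i + r),
              ρ ^ w.length * (‖F w (WithLp.toLp 2 (Function.update x i t))‖ₑ +
              ρ * ‖F (i :: w) (WithLp.toLp 2 (Function.update x i t))‖ₑ) := by
            rw [lintegral_const_mul]
            exact (hcu w).measurable.enorm.add ((hcu (i :: w)).measurable.enorm.const_mul _)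
          _ ≤ ∫⁻ t in Set.Icc (x i) (x i + r),
              2 * ((2 / ρ) ^ s.card * (∫⋯∫⁻_s, H ∂μ) (Function.update x i t)) :=
            lintegral_mono h2
          _ = _ := by
            rw [lintegral_const_mul _ (hml.const_mul _), lintegral_const_mul _ hml, ← mul_assoc,
              hxi]
      calc ρ ^ w.length * ‖F w (WithLp.toLp 2 x)‖ₑ
          = ρ⁻¹ * (ρ * (ρ ^ w.length * ‖F w (WithLp.toLp 2 x)‖ₑ)) := by
            rw [← mul_assoc, ENNReal.inv_mul_cancel hρ0 hρt, one_mul]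
        _ ≤ ρ⁻¹ * _ := mul_le_mul' le_rfl h3
        _ = _ := by rw [div_eq_mul_inv, pow_succ]; ring
  have h := claim Finset.univ [] (by simp) x₀.ofLp (fun _ _ => rfl)
  simp only [List.length_nil, pow_zero, one_mul, Finset.card_univ, Fintype.card_fin,
    lmarginal_univ] at h
  refine h.trans (le_of_eq ?_)
  congr 1
  rw [show Measure.pi μ = (volume : Measure (Fin n → ℝ)).restrict
      (Set.univ.pi fun i => Set.Icc (x₀ i) (x₀ i + r)) from (Measure.restrict_pi_pi _ _).symm,
    ← (PiLp.volume_preserving_toLp (Fin n)).setLIntegral_comp_preimage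
      (measurableSet_cornerBox x₀ r) hGm]
  congr 2
  ext z
  simp only [cornerBox, Set.mem_univ_pi, Set.mem_preimage, Set.mem_ofPred_eq]

/-- The oscillatory integral `∫ e^{i⟨v,ξ⟩} c(z,ξ) dξ`. -/
def symKer {n : ℕ} (c : Rn n → Rn n → ℂ) (z v : Rn n) : ℂ :=
  ∫ ξ : Rn n, Complex.exp (Complex.I * ((⟪v, ξ⟫_ℝ : ℝ) : ℂ)) * c z ξ

/-- The symbol `c` vanishes for frequencies of size larger than `ρ`. -/
def FreqSupp {n : ℕ} (ρ : ℝ) (c : Rn n → Rn n → ℂ) : Prop :=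
  ∀ z ξ, ρ < ‖ξ‖ → c z ξ = 0

section Kernel

variable {n : ℕ} {c : Rn n → Rn n → ℂ} {ρ : ℝ}

theorem FreqSupp.symDxWord (h : FreqSupp ρ c) (w : List (Fin n)) :
    FreqSupp ρ (symDxWord w c) :=
  fun z ξ hξ => symDxWord_eq_zero (fun z => h z ξ hξ) w z

theorem FreqSupp.symDxi_iterate (h : FreqSupp ρ c) (i : Fin n) (k : ℕ) :
    FreqSupp ρ ((symDxi i)^[k] c) :=
  symDxi_iterate_eq_zero h i k

theorem FreqSupp.hasCompactSupport (h : FreqSupp ρ c) (z : Rn n) : HasCompactSupport (c z) :=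
  HasCompactSupport.intro (isCompact_closedBall 0 ρ) fun ξ hξ => h z ξ (by simpa using hξ)

theorem FreqSupp.symKer_eq (h : FreqSupp ρ c) (z v : Rn n) :
    symKer c z v = ∫ ξ in Metric.closedBall 0 ρ,
      Complex.exp (Complex.I * ((⟪v, ξ⟫_ℝ : ℝ) : ℂ)) * c z ξ := by
  refine (setIntegral_eq_integral_of_forall_compl_eq_zero fun ξ hξ => ?_).symm
  rw [h z ξ (by simpa using hξ), mul_zero]

theorem continuous_symKer (hc : SymSmooth c) (h : FreqSupp ρ c) :
    Continuous fun p : Rn n × Rn n => symKer c p.1 p.2 := by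
  have hcc : Continuous (Function.uncurry c) := ContDiff.continuous hc
  simp_rw [h.symKer_eq]
  refine continuous_parametric_integral_of_continuous (f := fun (p : Rn n × Rn n) ξ =>
    Complex.exp (Complex.I * ((⟪p.2, ξ⟫_ℝ : ℝ) : ℂ)) * c p.1 ξ) ?_ (isCompact_closedBall 0 ρ)
  have h2 : Continuous fun q : (Rn n × Rn n) × Rn n => c q.1.1 q.2 :=
    hcc.comp (f := fun q : (Rn n × Rn n) × Rn n => (q.1.1, q.2)) (by fun_prop)
  refine Continuous.mul ?_ h2
  refine Complex.continuous_exp.comp (continuous_const.mul (Complex.continuous_ofReal.comp ?_))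
  exact Continuous.inner (by fun_prop) (by fun_prop)

theorem continuous_osc (v : Rn n) :
    Continuous fun ξ : Rn n => Complex.exp (Complex.I * ((⟪v, ξ⟫_ℝ : ℝ) : ℂ)) :=
  Complex.continuous_exp.comp (continuous_const.mul (Complex.continuous_ofReal.comp
    (Continuous.inner (by fun_prop) (by fun_prop))))

theorem integrable_osc_mul (hc : SymSmooth c) (h : FreqSupp ρ c) (z v : Rn n) :
    Integrable fun ξ : Rn n => Complex.exp (Complex.I * ((⟪v, ξ⟫_ℝ : ℝ) : ℂ)) * c z ξ :=
  ((continuous_osc v).mul (hc.right z).continuous).integrable_of_hasCompactSupport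
    (h.hasCompactSupport z).mul_left

theorem hasLineDerivAt_symKer (hc : SymSmooth c) (h : FreqSupp ρ c) (i : Fin n) (z v : Rn n) :
    HasLineDerivAt ℝ (fun z => symKer c z v) (symKer (symDx i c) z v) z
      (EuclideanSpace.single i 1) := by
  have hs : FreqSupp ρ (symDx i c) := h.symDxWord [i]
  have hdc : Continuous (Function.uncurry (symDx i c)) := ContDiff.continuous (hc.symDx i)
  set e : Rn n := EuclideanSpace.single i 1 with he
  obtain ⟨M, hM⟩ := ((isCompact_closedBall (0 : ℝ) 1).prod
    (isCompact_closedBall (0 : Rn n) ρ)).exists_bound_of_continuousOn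
    (f := fun p : ℝ × Rn n => symDx i c (z + p.1 • e) p.2)
    (hdc.comp (f := fun p : ℝ × Rn n => (z + p.1 • e, p.2)) (by fun_prop)).continuousOn
  have key := hasDerivAt_integral_of_dominated_loc_of_deriv_le
    (μ := (volume : Measure (Rn n)).restrict (Metric.closedBall 0 ρ)) (𝕜 := ℝ)
    (F := fun t ξ => Complex.exp (Complex.I * ((⟪v, ξ⟫_ℝ : ℝ) : ℂ)) * c (z + t • e) ξ)
    (F' := fun t ξ => Complex.exp (Complex.I * ((⟪v, ξ⟫_ℝ : ℝ) : ℂ)) * symDx i c (z + t • e) ξ)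
    (x₀ := 0) (s := Metric.closedBall 0 1) (bound := fun _ => M)
    (Metric.closedBall_mem_nhds _ one_pos)
    (Filter.Eventually.of_forall fun t =>
      ((continuous_osc v).mul (hc.right _).continuous).aestronglyMeasurable)
    (integrable_osc_mul hc h _ v).integrableOn
    ((continuous_osc v).mul ((hc.symDx i).right _).continuous).aestronglyMeasurable
    ?_ ?_ ?_
  · have h2 := key.2
    simp only [zero_smul, add_zero] at h2
    rw [← hs.symKer_eq] at h2
    refine HasDerivAt.congr_of_eventuallyEq h2 (Filter.Eventually.of_forall fun t => ?_)
    exact h.symKer_eq _ _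
  · filter_upwards [ae_restrict_mem Metric.isClosed_closedBall.measurableSet] with ξ hξ t ht
    rw [norm_mul, Complex.norm_exp_I_mul_ofReal, one_mul]
    exact hM (t, ξ) ⟨ht, hξ⟩
  · exact integrableOn_const (measure_closedBall_lt_top.ne)
  · refine Filter.Eventually.of_forall fun ξ t _ => ?_
    refine HasDerivAt.const_mul _ ?_
    have hd : HasFDerivAt (fun y => c y ξ) (fderiv ℝ (fun y => c y ξ) (z + t • e)) (z + t • e) :=
      ((hc.left ξ).differentiable (by simp) _).hasFDerivAt
    have hl : HasDerivAt (fun t : ℝ => z + t • e) e t := by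
      simpa using ((hasDerivAt_id t).smul_const e).const_add z
    exact hd.comp_hasDerivAt t hl

theorem symKer_symDxi (hc : SymSmooth c) (h : FreqSupp ρ c) (i : Fin n) (z v : Rn n) :
    symKer (symDxi i c) z v = -(Complex.I * (v i : ℂ)) * symKer c z v := by
  have hs : FreqSupp ρ (symDxi i c) := h.symDxi_iterate i 1
  have hder : ∀ ξ : Rn n, HasFDerivAt
      (fun ξ : Rn n => Complex.exp (Complex.I * ((⟪v, ξ⟫_ℝ : ℝ) : ℂ)))
      (Complex.exp (Complex.I * ((⟪v, ξ⟫_ℝ : ℝ) : ℂ)) •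
        (Complex.I • Complex.ofRealCLM.comp (innerSL ℝ v))) ξ := by
    intro ξ
    have h1 : HasFDerivAt (fun ξ : Rn n => ((⟪v, ξ⟫_ℝ : ℝ) : ℂ))
        (Complex.ofRealCLM.comp (innerSL ℝ v)) ξ :=
      (Complex.ofRealCLM.comp (innerSL ℝ v)).hasFDerivAt
    exact (h1.const_mul Complex.I).cexp
  have hval : ∀ ξ : Rn n, fderiv ℝ
      (fun ξ : Rn n => Complex.exp (Complex.I * ((⟪v, ξ⟫_ℝ : ℝ) : ℂ))) ξ
      (EuclideanSpace.single i 1) =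
      Complex.I * (v i : ℂ) * Complex.exp (Complex.I * ((⟪v, ξ⟫_ℝ : ℝ) : ℂ)) := by
    intro ξ
    rw [(hder ξ).fderiv]
    simp [EuclideanSpace.inner_single_right]
    ring
  have hi := integrable_osc_mul hc h z v
  have := integral_mul_fderiv_eq_neg_fderiv_mul_of_integrable (μ := volume)
    (f := fun ξ : Rn n => Complex.exp (Complex.I * ((⟪v, ξ⟫_ℝ : ℝ) : ℂ))) (g := c z)
    (v := EuclideanSpace.single i 1)
    (by simp_rw [hval, mul_assoc]; simpa only [mul_assoc] using (hi.const_mul _).const_mul _)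
    (integrable_osc_mul (hc.symDxi i) hs z v) hi
    (fun ξ _ => (hder ξ).differentiableAt)
    (fun ξ _ => (hc.right z).differentiable (by simp) ξ)
  change symKer (symDxi i c) z v = _ at this
  rw [this]
  simp_rw [hval, mul_assoc]
  rw [integral_const_mul, integral_const_mul]
  simp only [symKer]
  ring

theorem norm_symKer_symDxi_iterate (hc : SymSmooth c) (h : FreqSupp ρ c) (i : Fin n) (k : ℕ)
    (z v : Rn n) : ‖symKer ((symDxi i)^[k] c) z v‖ = |v i| ^ k * ‖symKer c z v‖ := by
  induction k with
  | zero => simp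
  | succ k ih =>
    rw [Function.iterate_succ_apply', symKer_symDxi (hc.symDxi_iterate i k)
      (h.symDxi_iterate i k), norm_mul, ih]
    simp [pow_succ]
    ring

theorem lintegral_enorm_symKer_sq_le (hc : SymSmooth c) (hρ : 0 ≤ ρ) (h : FreqSupp ρ c)
    {A : ℝ} (z : Rn n) (hA : ∀ ξ, ‖c z ξ‖ ≤ A) :
    ∫⁻ v, ‖symKer c z v‖ₑ ^ 2 ≤ ENNReal.ofReal
      ((2 * π) ^ n * (A ^ 2 * (ρ ^ n * volume.real (Metric.closedBall (0 : Rn n) 1)))) := by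
  have hA0 : 0 ≤ A := (norm_nonneg _).trans (hA 0)
  let g : SchwartzMap (Rn n) ℂ := (h.hasCompactSupport z).toSchwartzMap (hc.right z)
  have hker : ∀ v, symKer c z v = FourierTransform.fourier g ((-(2 * π)⁻¹ : ℝ) • v) := by
    intro v
    rw [SchwartzMap.fourier_coe, Real.fourier_eq', symKer]
    congr 1
    ext ξ
    change _ = _ • c z ξ
    rw [smul_eq_mul, real_inner_smul_right, real_inner_comm, mul_comm Complex.I]
    congr 4
    field_simp
  have hint : Integrable fun w => ‖FourierTransform.fourier g w‖ ^ 2 :=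
    ((FourierTransform.fourier g).memLp 2 volume).integrable_norm_pow (by norm_num)
  have hint2 : Integrable fun v => ‖symKer c z v‖ ^ 2 := by
    simp_rw [hker]
    exact hint.comp_smul (by simp [pi_ne_zero])
  have e1 : ∫⁻ v, ‖symKer c z v‖ₑ ^ 2 = ENNReal.ofReal (∫ v, ‖symKer c z v‖ ^ 2) := by
    rw [ofReal_integral_eq_lintegral_ofReal hint2
      (Filter.Eventually.of_forall fun v => by positivity)]
    congr 1
    ext v
    rw [ENNReal.ofReal_pow (norm_nonneg _), ofReal_norm]
  rw [e1]
  refine ENNReal.ofReal_le_ofReal ?_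
  simp_rw [hker]
  rw [Measure.integral_comp_smul volume (fun w => ‖FourierTransform.fourier g w‖ ^ 2),
    SchwartzMap.integral_norm_sq_fourier]
  have e2 : |((-(2 * π)⁻¹) ^ Module.finrank ℝ (Rn n))⁻¹| = (2 * π) ^ n := by
    rw [finrank_euclideanSpace_fin, abs_inv, abs_pow, abs_neg, abs_inv, inv_pow, inv_inv,
      abs_of_pos (by positivity)]
  rw [e2, smul_eq_mul]
  gcongr
  change ∫ ξ, ‖c z ξ‖ ^ 2 ≤ _
  rw [← setIntegral_eq_integral_of_forall_compl_eq_zero (s := Metric.closedBall 0 ρ)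
    (fun ξ hξ => by rw [h z ξ (by simpa using hξ)]; simp)]
  have hb : volume.real (Metric.closedBall (0 : Rn n) ρ) =
      ρ ^ n * volume.real (Metric.closedBall (0 : Rn n) 1) := by
    rw [Measure.real, Measure.addHaar_closedBall' volume _ hρ, finrank_euclideanSpace_fin,
      ENNReal.toReal_mul, ENNReal.toReal_ofReal (by positivity), Measure.real]
  rw [← hb, mul_comm, ← smul_eq_mul, ← setIntegral_const]
  refine setIntegral_mono ?_ (integrableOn_const measure_closedBall_lt_top.ne) fun ξ => ?_
  · exact ((hc.right z).continuous.norm.pow 2).continuousOn.integrableOn_compact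
      (isCompact_closedBall 0 ρ)
  · have := hA ξ
    simp only
    gcongr

end Kernel

theorem EuclideanSpace.norm_le_card_mul {n : ℕ} {v : Rn n} {s : ℝ} (h : ∀ i, |v i| ≤ s)
    (hs : 0 ≤ s) : ‖v‖ ≤ n * s := by
  rw [EuclideanSpace.norm_eq]
  refine Real.sqrt_le_iff.2 ⟨by positivity, ?_⟩
  calc ∑ i, ‖v i‖ ^ 2 ≤ ∑ _i : Fin n, s ^ 2 :=
        Finset.sum_le_sum fun i _ => pow_le_pow_left₀ (norm_nonneg _) (h i) 2
    _ = n * s ^ 2 := by simp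
    _ ≤ (n * s) ^ 2 := by
        rw [mul_pow]
        gcongr
        rcases Nat.eq_zero_or_pos n with rfl | hn
        · simp
        · have : (1 : ℝ) ≤ n := by exact_mod_cast hn
          nlinarith

theorem setLIntegral_le_of_lintegral_sq_le {α : Type*} [MeasurableSpace α] {μ : Measure α}
    {f : α → ℝ≥0∞} (hf : AEMeasurable f μ) {S : Set α} (hS : MeasurableSet S) {s B : ℝ}
    (hs : 0 ≤ s) (hB : 0 ≤ B) (hSv : μ S ≤ ENNReal.ofReal (s ^ 2))
    (hfB : ∫⁻ x, f x ^ 2 ∂μ ≤ ENNReal.ofReal (B ^ 2)) :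
    ∫⁻ x in S, f x ∂μ ≤ ENNReal.ofReal (s * B) := by
  have hh := ENNReal.lintegral_mul_le_Lp_mul_Lq μ Real.HolderConjugate.two_two
    (f := S.indicator 1) (g := f) (aemeasurable_const.indicator hS) hf
  have e1 : ∫⁻ x, ((S.indicator 1 : α → ℝ≥0∞) * f) x ∂μ = ∫⁻ x in S, f x ∂μ := by
    rw [← lintegral_indicator hS]
    congr 1
    ext x
    by_cases hx : x ∈ S <;> simp [hx]
  have e2 : ∫⁻ x, (S.indicator 1 x : ℝ≥0∞) ^ (2 : ℝ) ∂μ = μ S := by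
    rw [← lintegral_indicator_one hS]
    congr 1
    ext x
    by_cases hx : x ∈ S <;> simp [hx]
  have root : ∀ {t : ℝ}, 0 ≤ t → (ENNReal.ofReal (t ^ 2)) ^ (1 / (2 : ℝ)) = ENNReal.ofReal t := by
    intro t ht
    rw [ENNReal.ofReal_rpow_of_nonneg (by positivity) (by norm_num), ← Real.sqrt_eq_rpow,
      Real.sqrt_sq ht]
  rw [e1, e2] at hh
  refine hh.trans ?_
  rw [ENNReal.ofReal_mul hs, ← root hs, ← root hB]
  gcongr
  simpa using hfB

section Weight

variable {n : ℕ}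

/-- The integrable weight `(1 + R|v|)^{-(n+1)}`. -/
def decayWeight (R : ℝ) (v : Rn n) : ℝ := ((1 + R * ‖v‖) ^ (n + 1))⁻¹

theorem continuous_decayWeight {R : ℝ} (hR : 0 < R) :
    Continuous (decayWeight R : Rn n → ℝ) := by
  unfold decayWeight
  exact Continuous.inv₀ (by fun_prop) fun v => by positivity

theorem integrable_decayWeight_one : Integrable (decayWeight 1 : Rn n → ℝ) := by
  have := integrable_one_add_norm (E := Rn n) (μ := volume) (r := n + 1)
    (by rw [finrank_euclideanSpace_fin]; linarith)
  refine this.congr (Filter.Eventually.of_forall fun v => ?_)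
  simp only [decayWeight, one_mul]
  rw [Real.rpow_neg (by positivity)]
  norm_cast

theorem lintegral_decayWeight {R : ℝ} (hR : 0 < R) (y : Rn n) :
    ∫⁻ z : Rn n, ENNReal.ofReal (decayWeight R (z - y)) =
      ENNReal.ofReal ((R ^ n)⁻¹ * ∫ v : Rn n, decayWeight 1 v) := by
  rw [lintegral_sub_right_eq_self (fun z : Rn n => ENNReal.ofReal (decayWeight R z)) y]
  have e : ∀ v : Rn n, decayWeight R v = decayWeight 1 (R • v) := by
    intro v
    simp [decayWeight, norm_smul, abs_of_pos hR]
  have hnn : ∀ v : Rn n, 0 ≤ decayWeight R v := fun v => by unfold decayWeight; positivity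
  have hi : Integrable (decayWeight R : Rn n → ℝ) := by
    rw [funext e]
    exact integrable_decayWeight_one.comp_smul hR.ne'
  rw [← ofReal_integral_eq_lintegral_ofReal hi (Filter.Eventually.of_forall hnn)]
  congr 1
  simp_rw [e]
  rw [Measure.integral_comp_smul, finrank_euclideanSpace_fin, smul_eq_mul,
    abs_of_pos (by positivity)]

theorem decayWeight_le_of_mem_cornerBox {r R : ℝ} (hr : 0 ≤ r) (hR : 0 ≤ R) (hrR : r * R ≤ 1)
    {x z : Rn n} (hz : z ∈ cornerBox x r) (y : Rn n) :
    decayWeight R (x - y) ≤ (1 + n) ^ (n + 1) * decayWeight R (z - y) := by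
  have h1 : ‖z - x‖ ≤ n * r := EuclideanSpace.norm_le_card_mul (fun i => by
    have := hz i
    rw [Set.mem_Icc] at this
    rw [PiLp.sub_apply, abs_le]
    constructor <;> linarith) hr
  have h2 : 1 + R * ‖z - y‖ ≤ (1 + n) * (1 + R * ‖x - y‖) := by
    have h3 : ‖z - y‖ ≤ ‖z - x‖ + ‖x - y‖ := norm_sub_le_norm_sub_add_norm_sub z x y
    have h4 : R * ‖z - y‖ ≤ n * (r * R) + R * ‖x - y‖ := by
      nlinarith [mul_le_mul_of_nonneg_left h3 hR, mul_le_mul_of_nonneg_left h1 hR]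
    have h5 : (n : ℝ) * (r * R) ≤ n * 1 := by gcongr
    have h6 : 0 ≤ n * (R * ‖x - y‖) := by positivity
    nlinarith
  unfold decayWeight
  rw [← div_eq_mul_inv, le_div_iff₀ (by positivity), inv_mul_le_iff₀ (by positivity),
    mul_comm ((1 + R * ‖x - y‖) ^ (n + 1)), ← mul_pow]
  exact pow_le_pow_left₀ (by positivity) h2 _

end Weight

section WeightedBound

variable {n : ℕ}

theorem measurableSet_mem_cornerBox (r : ℝ) :
    MeasurableSet {p : Rn n × Rn n | p.2 ∈ cornerBox p.1 r} := by
  have : {p : Rn n × Rn n | p.2 ∈ cornerBox p.1 r} =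
      ⋂ i, {p : Rn n × Rn n | p.1 i ≤ p.2 i} ∩ {p | p.2 i ≤ p.1 i + r} := by
    ext p
    simp [cornerBox]
  rw [this]
  refine MeasurableSet.iInter fun i => (IsClosed.inter ?_ ?_).measurableSet
  · exact isClosed_le (by fun_prop) (by fun_prop)
  · exact isClosed_le (by fun_prop) (by fun_prop)

theorem setLIntegral_enorm_symKer_le {c : Rn n → Rn n → ℂ} {r ρ A : ℝ} (hr : 0 ≤ r)
    (hρ : 0 ≤ ρ) (hc : SymSmooth c) (h : FreqSupp ρ c) (z y : Rn n) (hA : ∀ ξ, ‖c z ξ‖ ≤ A) :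
    ∫⁻ x in {x | z ∈ cornerBox x r}, ‖symKer c z (x - y)‖ₑ ≤
      ENNReal.ofReal (√((n * r) ^ n * volume.real (Metric.closedBall (0 : Rn n) 1)) *
        (√((2 * π) ^ n * volume.real (Metric.closedBall (0 : Rn n) 1)) * A * √(ρ ^ n))) := by
  have hA0 : 0 ≤ A := (norm_nonneg _).trans (hA 0)
  have hcont : Continuous fun x => symKer c z (x - y) :=
    (continuous_symKer hc h).comp (f := fun x => (z, x - y)) (by fun_prop)
  refine setLIntegral_le_of_lintegral_sq_le hcont.measurable.enorm.aemeasurable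
    ((measurableSet_mem_cornerBox r).preimage (f := fun x => (x, z)) (by fun_prop))
    (by positivity) (by positivity) ?_ ?_
  · rw [Real.sq_sqrt (by positivity), ENNReal.ofReal_mul (by positivity),
      ofReal_measureReal measure_closedBall_lt_top.ne]
    have := Measure.addHaar_closedBall' (volume : Measure (Rn n)) z (r := n * r) (by positivity)
    rw [finrank_euclideanSpace_fin] at this
    rw [← this]
    refine measure_mono fun x hx => ?_
    rw [Metric.mem_closedBall, dist_eq_norm]
    refine EuclideanSpace.norm_le_card_mul (fun i => ?_) hr
    have hxi := hx i
    rw [Set.mem_Icc] at hxi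
    rw [PiLp.sub_apply, abs_le]
    constructor <;> linarith
  · rw [lintegral_sub_right_eq_self (fun v => ‖symKer c z v‖ₑ ^ 2) y]
    refine (lintegral_enorm_symKer_sq_le hc hρ h z hA).trans (le_of_eq ?_)
    rw [mul_pow _ (√(ρ ^ n)), mul_pow _ A, Real.sq_sqrt (by positivity),
      Real.sq_sqrt (by positivity)]
    ring_nf

/-- A constant, depending only on the dimension, for the weighted kernel bound. -/
def kerConst (n : ℕ) : ℝ :=
  2 ^ n * ((List.finite_length_le (Fin n) n).toFinset.card *
    ((1 + n) ^ (n + 1) * ((∫ v : Rn n, decayWeight 1 v) *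
    (√(n ^ n * volume.real (Metric.closedBall (0 : Rn n) 1)) *
      √((2 * π) ^ n * volume.real (Metric.closedBall (0 : Rn n) 1))))))

theorem lintegral_decayWeight_mul_enorm_symKer_le {c : Rn n → Rn n → ℂ} {r R ρ A : ℝ}
    (hr : 0 < r) (hR : 0 < R) (hrR : r * R ≤ 1) (hρ : 0 ≤ ρ) (hc : SymSmooth c)
    (h : FreqSupp ρ c)
    (hA : ∀ w : List (Fin n), w.length ≤ n → ∀ z ξ, r ^ w.length * ‖symDxWord w c z ξ‖ ≤ A)
    (y : Rn n) :
    ∫⁻ x, ENNReal.ofReal (decayWeight R (x - y)) * ‖symKer c x (x - y)‖ₑ ≤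
      ENNReal.ofReal (kerConst n * (A * (√(ρ ^ n) / (√(r ^ n) * R ^ n)))) := by
  set W := (List.finite_length_le (Fin n) n).toFinset with hW
  have hA0 : 0 ≤ A := le_trans (by positivity) (hA [] (by simp) 0 0)
  set V := volume.real (Metric.closedBall (0 : Rn n) 1) with hV
  set I := ∫ v : Rn n, decayWeight 1 v with hI
  have hI0 : 0 ≤ I := integral_nonneg fun v => by unfold decayWeight; positivity
  have hcs : ∀ w, SymSmooth (symDxWord w c) := fun w => hc.symDxWord w
  have hks : ∀ w, Continuous fun p : Rn n × Rn n => symKer (symDxWord w c) p.1 p.2 :=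
    fun w => continuous_symKer (hcs w) (h.symDxWord w)
  have sob : ∀ x, ‖symKer c x (x - y)‖ₑ ≤ (2 / ENNReal.ofReal r) ^ n *
      ∫⁻ z in cornerBox x r, ∑ w ∈ W,
        ENNReal.ofReal r ^ w.length * ‖symKer (symDxWord w c) z (x - y)‖ₑ := by
    intro x
    refine enorm_le_lintegral_cornerBox hr (fun w z => symKer (symDxWord w c) z (x - y))
      (fun w => (hks w).comp (f := fun z => (z, x - y)) (by fun_prop))
      (fun w i z => hasLineDerivAt_symKer (hcs w) (h.symDxWord w) i z _) _ ?_ ?_ x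
    · refine Finset.measurable_fun_sum _ fun w _ => Measurable.const_mul ?_ _
      exact ((hks w).comp (f := fun z => (z, x - y)) (by fun_prop)).measurable.enorm
    · intro w hw z
      exact Finset.single_le_sum (f := fun w => ENNReal.ofReal r ^ w.length *
        ‖symKer (symDxWord w c) z (x - y)‖ₑ) (fun _ _ => zero_le) (by simpa [hW] using hw)
  have hmeas : ∀ w, Measurable fun p : Rn n × Rn n => ‖symKer (symDxWord w c) p.2 (p.1 - y)‖ₑ :=
    fun w => ((hks w).comp (f := fun p : Rn n × Rn n => (p.2, p.1 - y))
      (by fun_prop)).measurable.enorm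
  have hwm : Measurable fun x : Rn n => ENNReal.ofReal (decayWeight R (x - y)) :=
    ENNReal.measurable_ofReal.comp ((continuous_decayWeight hR).comp
      (continuous_sub_right y)).measurable
  set B : ℝ := √((n * r) ^ n * V) * (√((2 * π) ^ n * V) * A * √(ρ ^ n)) with hB
  have hB0 : 0 ≤ B := by positivity
  have word : ∀ w ∈ W, ∫⁻ x, ENNReal.ofReal (decayWeight R (x - y)) *
      ∫⁻ z in cornerBox x r, ENNReal.ofReal r ^ w.length * ‖symKer (symDxWord w c) z (x - y)‖ₑ ≤
      ENNReal.ofReal ((1 + n) ^ (n + 1) * ((R ^ n)⁻¹ * I * B)) := by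
    intro w hw
    have hwl : w.length ≤ n := by simpa [hW] using hw
    have m1 : Measurable fun p : Rn n × Rn n => ENNReal.ofReal r ^ w.length *
        {p : Rn n × Rn n | p.2 ∈ cornerBox p.1 r}.indicator
          (fun p => ‖symKer (symDxWord w c) p.2 (p.1 - y)‖ₑ) p :=
      ((hmeas w).indicator (measurableSet_mem_cornerBox r)).const_mul _
    calc ∫⁻ x, ENNReal.ofReal (decayWeight R (x - y)) *
          ∫⁻ z in cornerBox x r, ENNReal.ofReal r ^ w.length *
            ‖symKer (symDxWord w c) z (x - y)‖ₑ
        = ∫⁻ x, ∫⁻ z, ENNReal.ofReal (decayWeight R (x - y)) * (ENNReal.ofReal r ^ w.length *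
            {p : Rn n × Rn n | p.2 ∈ cornerBox p.1 r}.indicator
            (fun p => ‖symKer (symDxWord w c) p.2 (p.1 - y)‖ₑ) (x, z)) := by
          refine lintegral_congr fun x => ?_
          refine Eq.trans ?_ (lintegral_const_mul _
            (m1.comp (f := fun z => (x, z)) (by fun_prop))).symm
          rw [← lintegral_indicator (measurableSet_cornerBox x r)]
          congr 1
          refine lintegral_congr fun z => ?_
          by_cases hz : z ∈ cornerBox x r <;> simp [Set.indicator, hz]
      _ ≤ ∫⁻ x, ∫⁻ z, ENNReal.ofReal ((1 + n) ^ (n + 1) * decayWeight R (z - y)) *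
            (ENNReal.ofReal r ^ w.length *
            {p : Rn n × Rn n | p.2 ∈ cornerBox p.1 r}.indicator
            (fun p => ‖symKer (symDxWord w c) p.2 (p.1 - y)‖ₑ) (x, z)) := by
          refine lintegral_mono fun x => lintegral_mono fun z => ?_
          by_cases hz : z ∈ cornerBox x r
          · gcongr
            exact decayWeight_le_of_mem_cornerBox hr.le hR.le hrR hz y
          · simp [Set.indicator, hz]
      _ = ∫⁻ z, ∫⁻ x, ENNReal.ofReal ((1 + n) ^ (n + 1) * decayWeight R (z - y)) *
            (ENNReal.ofReal r ^ w.length *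
            {p : Rn n × Rn n | p.2 ∈ cornerBox p.1 r}.indicator
            (fun p => ‖symKer (symDxWord w c) p.2 (p.1 - y)‖ₑ) (x, z)) := by
          refine lintegral_lintegral_swap (Measurable.aemeasurable ?_)
          refine Measurable.mul ?_ m1
          simp_rw [ENNReal.ofReal_mul (show (0 : ℝ) ≤ (1 + n) ^ (n + 1) by positivity)]
          exact (hwm.comp measurable_snd).const_mul _
      _ ≤ ∫⁻ z, ENNReal.ofReal ((1 + n) ^ (n + 1) * decayWeight R (z - y)) *
            ENNReal.ofReal B := by
          refine lintegral_mono fun z => ?_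
          have m2 : Measurable fun x : Rn n => {p : Rn n × Rn n | p.2 ∈ cornerBox p.1 r}.indicator
              (fun p => ‖symKer (symDxWord w c) p.2 (p.1 - y)‖ₑ) (x, z) :=
            ((hmeas w).indicator (measurableSet_mem_cornerBox r)).comp
              (f := fun x : Rn n => (x, z)) (by fun_prop)
          rw [lintegral_const_mul _ (m2.const_mul _), lintegral_const_mul _ m2]
          gcongr
          have e3 : ∫⁻ x, {p : Rn n × Rn n | p.2 ∈ cornerBox p.1 r}.indicator
              (fun p => ‖symKer (symDxWord w c) p.2 (p.1 - y)‖ₑ) (x, z) =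
              ∫⁻ x in {x | z ∈ cornerBox x r}, ‖symKer (symDxWord w c) z (x - y)‖ₑ := by
            refine Eq.trans ?_ (lintegral_indicator ((measurableSet_mem_cornerBox r).preimage
              (f := fun x => (x, z)) (by fun_prop)) _)
            rfl
          rw [e3]
          have := setLIntegral_enorm_symKer_le hr.le hρ (hcs w) (h.symDxWord w) z y
            (A := A / r ^ w.length) (fun ξ => by
              rw [le_div_iff₀ (by positivity), mul_comm]
              exact hA w hwl z ξ)
          refine (mul_le_mul_right this _).trans (le_of_eq ?_)
          rw [← ENNReal.ofReal_pow hr.le, ← ENNReal.ofReal_mul (by positivity)]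
          congr 1
          rw [hB, hV]
          field_simp
      _ = _ := by
          rw [lintegral_mul_const _ (by
            simp_rw [ENNReal.ofReal_mul (show (0 : ℝ) ≤ (1 + n) ^ (n + 1) by positivity)]
            exact hwm.const_mul _)]
          simp_rw [ENNReal.ofReal_mul (show (0 : ℝ) ≤ (1 + n) ^ (n + 1) by positivity)]
          rw [lintegral_const_mul _ hwm, lintegral_decayWeight hR, mul_assoc,
            ← ENNReal.ofReal_mul (by positivity)]
  have hmeas2 : ∀ w, Measurable fun x => ∫⁻ z in cornerBox x r,
      ENNReal.ofReal r ^ w.length * ‖symKer (symDxWord w c) z (x - y)‖ₑ := by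
    intro w
    have m1 : Measurable fun p : Rn n × Rn n =>
        {p : Rn n × Rn n | p.2 ∈ cornerBox p.1 r}.indicator
          (fun p => ENNReal.ofReal r ^ w.length * ‖symKer (symDxWord w c) p.2 (p.1 - y)‖ₑ) p :=
      ((hmeas w).const_mul _).indicator (measurableSet_mem_cornerBox r)
    convert m1.lintegral_prod_right' (ν := volume) using 2 with x
    rw [← lintegral_indicator (measurableSet_cornerBox x r)]
    rfl
  calc ∫⁻ x, ENNReal.ofReal (decayWeight R (x - y)) * ‖symKer c x (x - y)‖ₑ
      ≤ ∫⁻ x, (2 / ENNReal.ofReal r) ^ n * ∑ w ∈ W, ENNReal.ofReal (decayWeight R (x - y)) *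
        ∫⁻ z in cornerBox x r,
          ENNReal.ofReal r ^ w.length * ‖symKer (symDxWord w c) z (x - y)‖ₑ := by
        refine lintegral_mono fun x => ?_
        rw [← Finset.mul_sum, ← mul_assoc, mul_comm (_ ^ n), mul_assoc]
        gcongr
        refine (sob x).trans (le_of_eq ?_)
        congr 1
        refine lintegral_finsetSum _ fun w _ => Measurable.const_mul ?_ _
        exact ((hks w).comp (f := fun z => (z, x - y)) (by fun_prop)).measurable.enorm
    _ = (2 / ENNReal.ofReal r) ^ n * ∑ w ∈ W, ∫⁻ x, ENNReal.ofReal (decayWeight R (x - y)) *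
        ∫⁻ z in cornerBox x r,
          ENNReal.ofReal r ^ w.length * ‖symKer (symDxWord w c) z (x - y)‖ₑ := by
        rw [lintegral_const_mul, lintegral_finsetSum]
        · exact fun w _ => hwm.mul (hmeas2 w)
        · exact Finset.measurable_fun_sum _ fun w _ => hwm.mul (hmeas2 w)
    _ ≤ (2 / ENNReal.ofReal r) ^ n * ∑ w ∈ W,
          ENNReal.ofReal ((1 + n) ^ (n + 1) * ((R ^ n)⁻¹ * I * B)) := by
        gcongr with w hw
        exact word w hw
    _ = _ := by
        have e2 : (2 / ENNReal.ofReal r : ℝ≥0∞) = ENNReal.ofReal (2 / r) := by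
          rw [ENNReal.ofReal_div_of_pos hr, ENNReal.ofReal_ofNat]
        rw [Finset.sum_const, nsmul_eq_mul, e2, ← ENNReal.ofReal_pow (by positivity),
          ← ENNReal.ofReal_natCast, ← ENNReal.ofReal_mul (by positivity),
          ← ENNReal.ofReal_mul (by positivity)]
        congr 1
        have e4 : √((n * r) ^ n * V) = √(n ^ n * V) * √(r ^ n) := by
          rw [← Real.sqrt_mul (by positivity)]
          ring_nf
        have e5 : r ^ n = √(r ^ n) * √(r ^ n) := (Real.mul_self_sqrt (by positivity)).symm
        have e6 : √(r ^ n) ≠ 0 := by positivity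
        rw [hB, e4, kerConst, ← hW, ← hV, ← hI, div_pow]
        nth_rewrite 1 [e5]
        generalize √(r ^ n) = t1 at *
        generalize √(ρ ^ n) = t2 at *
        generalize √((2 * π) ^ n * V) = t3
        generalize √(n ^ n * V) = t4
        have e7 : R ^ n ≠ 0 := by positivity
        field_simp

end WeightedBound

theorem one_le_decayWeight_mul {n : ℕ} (hn : 1 ≤ n) {R : ℝ} (hR : 0 ≤ R) (v : Rn n) :
    1 ≤ 2 ^ n * n ^ (n + 1) *
      (decayWeight R v * (1 + ∑ i, R ^ (n + 1) * |v i| ^ (n + 1))) := by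
  have : Nonempty (Fin n) := ⟨⟨0, hn⟩⟩
  have hn1 : (1 : ℝ) ≤ n := by exact_mod_cast hn
  obtain ⟨i₀, hi₀⟩ := Finite.exists_max fun i => |v i|
  have h1 : ‖v‖ ≤ n * |v i₀| := EuclideanSpace.norm_le_card_mul hi₀ (abs_nonneg _)
  have h2 : (1 + R * ‖v‖) ^ (n + 1) ≤
      2 ^ n * n ^ (n + 1) * (1 + ∑ i, R ^ (n + 1) * |v i| ^ (n + 1)) := by
    calc (1 + R * ‖v‖) ^ (n + 1) ≤ (1 + R * (n * |v i₀|)) ^ (n + 1) := by gcongr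
      _ ≤ 2 ^ (n + 1 - 1) * (1 ^ (n + 1) + (R * (n * |v i₀|)) ^ (n + 1)) :=
          add_pow_le zero_le_one (by positivity) _
      _ = 2 ^ n * (1 + n ^ (n + 1) * (R ^ (n + 1) * |v i₀| ^ (n + 1))) := by
          rw [Nat.add_sub_cancel, one_pow, mul_pow, mul_pow]
          ring
      _ ≤ 2 ^ n * (n ^ (n + 1) * 1 + n ^ (n + 1) * (R ^ (n + 1) * |v i₀| ^ (n + 1))) := by
          gcongr
          rw [mul_one]
          exact one_le_pow₀ hn1
      _ = 2 ^ n * n ^ (n + 1) * (1 + R ^ (n + 1) * |v i₀| ^ (n + 1)) := by ring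
      _ ≤ _ := by
          gcongr
          exact Finset.single_le_sum (f := fun i => R ^ (n + 1) * |v i| ^ (n + 1))
            (fun i _ => by positivity) (Finset.mem_univ i₀)
  have h3 : (1 + R * ‖v‖) ^ (n + 1) * decayWeight R v = 1 :=
    mul_inv_cancel₀ (by positivity)
  have h4 : 0 ≤ decayWeight R v := by unfold decayWeight; positivity
  calc (1 : ℝ) = (1 + R * ‖v‖) ^ (n + 1) * decayWeight R v := h3.symm
    _ ≤ 2 ^ n * n ^ (n + 1) * (1 + ∑ i, R ^ (n + 1) * |v i| ^ (n + 1)) * decayWeight R v := by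
        gcongr
    _ = _ := by ring

/-- An `L¹` bound, uniform in `y`, for the kernel of the operator with a frequency localised
symbol, in terms of `x`-derivatives at scale `r` and `ξ`-derivatives at scale `R`. -/
theorem lintegral_enorm_symKer_le {n : ℕ} (hn : 1 ≤ n) {b : Rn n → Rn n → ℂ} {r R ρ A : ℝ}
    (hr : 0 < r) (hR : 0 < R) (hrR : r * R ≤ 1) (hρ : 0 ≤ ρ) (hb : SymSmooth b)
    (h : FreqSupp ρ b)
    (hA : ∀ w : List (Fin n), w.length ≤ n → ∀ z ξ, r ^ w.length * ‖symDxWord w b z ξ‖ ≤ A)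
    (hA' : ∀ w : List (Fin n), w.length ≤ n → ∀ i z ξ,
      r ^ w.length * (R ^ (n + 1) * ‖symDxWord w ((symDxi i)^[n + 1] b) z ξ‖) ≤ A)
    (y : Rn n) :
    ∫⁻ x, ‖symKer b x (x - y)‖ₑ ≤ ENNReal.ofReal
      (2 ^ n * n ^ (n + 1) * ((1 + n) * kerConst n) *
        (A * (√(ρ ^ n) / (√(r ^ n) * R ^ n)))) := by
  have hA0 : 0 ≤ A := le_trans (by positivity) (hA [] (by simp) 0 0)
  set D : ℝ := kerConst n * (A * (√(ρ ^ n) / (√(r ^ n) * R ^ n))) with hD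
  have hD0 : 0 ≤ D := by
    have : 0 ≤ kerConst n := by
      have : 0 ≤ ∫ v : Rn n, decayWeight 1 v :=
        integral_nonneg fun v => by unfold decayWeight; positivity
      unfold kerConst
      positivity
    positivity
  have hcont : ∀ {c : Rn n → Rn n → ℂ}, SymSmooth c → FreqSupp ρ c →
      Measurable fun x => ‖symKer c x (x - y)‖ₑ := fun hc h =>
    ((continuous_symKer hc h).comp (f := fun x => (x, x - y)) (by fun_prop)).measurable.enorm
  have hwm : Measurable fun x : Rn n => ENNReal.ofReal (decayWeight R (x - y)) :=
    ENNReal.measurable_ofReal.comp ((continuous_decayWeight hR).comp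
      (continuous_sub_right y)).measurable
  have pt : ∀ x, ‖symKer b x (x - y)‖ₑ ≤ ENNReal.ofReal (2 ^ n * n ^ (n + 1)) *
      (ENNReal.ofReal (decayWeight R (x - y)) * ‖symKer b x (x - y)‖ₑ +
        ∑ i, ENNReal.ofReal (R ^ (n + 1)) * (ENNReal.ofReal (decayWeight R (x - y)) *
          ‖symKer ((symDxi i)^[n + 1] b) x (x - y)‖ₑ)) := by
    intro x
    have h4 : 0 ≤ decayWeight R (x - y) := by unfold decayWeight; positivity
    have key : ‖symKer b x (x - y)‖ ≤ 2 ^ n * n ^ (n + 1) *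
        (decayWeight R (x - y) * ‖symKer b x (x - y)‖ +
        ∑ i, R ^ (n + 1) * (decayWeight R (x - y) *
          ‖symKer ((symDxi i)^[n + 1] b) x (x - y)‖)) := by
      simp_rw [norm_symKer_symDxi_iterate hb h]
      have := mul_le_mul_of_nonneg_right (one_le_decayWeight_mul hn hR.le (x - y))
        (norm_nonneg (symKer b x (x - y)))
      rw [one_mul] at this
      refine this.trans (le_of_eq ?_)
      have e : ∑ i, R ^ (n + 1) * (decayWeight R (x - y) *
          (|(x - y) i| ^ (n + 1) * ‖symKer b x (x - y)‖)) =
          decayWeight R (x - y) * ‖symKer b x (x - y)‖ *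
            ∑ i, R ^ (n + 1) * |(x - y) i| ^ (n + 1) := by
        rw [Finset.mul_sum]
        exact Finset.sum_congr rfl fun i _ => by ring
      rw [e]
      ring
    calc ‖symKer b x (x - y)‖ₑ = ENNReal.ofReal ‖symKer b x (x - y)‖ := (ofReal_norm _).symm
      _ ≤ _ := ENNReal.ofReal_le_ofReal key
      _ = _ := by
        rw [ENNReal.ofReal_mul (by positivity), ENNReal.ofReal_add (by positivity)
          (Finset.sum_nonneg fun i _ => by positivity), ENNReal.ofReal_mul h4, ofReal_norm,
          ENNReal.ofReal_sum_of_nonneg (fun i _ => by positivity)]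
        congr 2
        refine Finset.sum_congr rfl fun i _ => ?_
        rw [ENNReal.ofReal_mul (by positivity), ENNReal.ofReal_mul h4, ofReal_norm]
  have hi : ∀ i, ENNReal.ofReal (R ^ (n + 1)) * ∫⁻ x, ENNReal.ofReal (decayWeight R (x - y)) *
      ‖symKer ((symDxi i)^[n + 1] b) x (x - y)‖ₑ ≤ ENNReal.ofReal D := by
    intro i
    have := lintegral_decayWeight_mul_enorm_symKer_le hr hR hrR hρ (hb.symDxi_iterate i (n + 1))
      (h.symDxi_iterate i (n + 1)) (A := A / R ^ (n + 1)) (fun w hw z ξ => by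
        rw [le_div_iff₀ (by positivity)]
        refine le_of_eq_of_le ?_ (hA' w hw i z ξ)
        ring) y
    refine (mul_le_mul_right this _).trans (le_of_eq ?_)
    rw [← ENNReal.ofReal_mul (by positivity)]
    congr 1
    rw [hD]
    field_simp
  calc ∫⁻ x, ‖symKer b x (x - y)‖ₑ
      ≤ ∫⁻ x, ENNReal.ofReal (2 ^ n * n ^ (n + 1)) *
        (ENNReal.ofReal (decayWeight R (x - y)) * ‖symKer b x (x - y)‖ₑ +
        ∑ i, ENNReal.ofReal (R ^ (n + 1)) * (ENNReal.ofReal (decayWeight R (x - y)) *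
          ‖symKer ((symDxi i)^[n + 1] b) x (x - y)‖ₑ)) := lintegral_mono pt
    _ = ENNReal.ofReal (2 ^ n * n ^ (n + 1)) *
        ((∫⁻ x, ENNReal.ofReal (decayWeight R (x - y)) * ‖symKer b x (x - y)‖ₑ) +
        ∑ i, ENNReal.ofReal (R ^ (n + 1)) * ∫⁻ x, ENNReal.ofReal (decayWeight R (x - y)) *
          ‖symKer ((symDxi i)^[n + 1] b) x (x - y)‖ₑ) := by
        have m1 : Measurable fun x => ENNReal.ofReal (decayWeight R (x - y)) *
            ‖symKer b x (x - y)‖ₑ := hwm.mul (hcont hb h)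
        have m2 : ∀ i, Measurable fun x => ENNReal.ofReal (decayWeight R (x - y)) *
            ‖symKer ((symDxi i)^[n + 1] b) x (x - y)‖ₑ := fun i => hwm.mul
          (hcont (hb.symDxi_iterate i (n + 1)) (h.symDxi_iterate i (n + 1)))
        have m3 := Finset.measurable_fun_sum Finset.univ fun i _ =>
          (m2 i).const_mul (ENNReal.ofReal (R ^ (n + 1)))
        rw [lintegral_const_mul _ (by exact m1.add m3), lintegral_add_left m1,
          lintegral_finsetSum _ fun i _ => (m2 i).const_mul _]
        congr 2
        exact Finset.sum_congr rfl fun i _ => lintegral_const_mul _ (m2 i)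
    _ ≤ ENNReal.ofReal (2 ^ n * n ^ (n + 1)) * (ENNReal.ofReal D +
        ∑ _i : Fin n, ENNReal.ofReal D) := by
        gcongr with i
        · exact lintegral_decayWeight_mul_enorm_symKer_le hr hR hrR hρ hb h hA y
        · exact hi i
    _ = _ := by
        rw [Finset.sum_const, Finset.card_univ, Fintype.card_fin, nsmul_eq_mul,
          ← ENNReal.ofReal_natCast, ← ENNReal.ofReal_mul (by positivity),
          ← ENNReal.ofReal_add hD0 (by positivity), ← ENNReal.ofReal_mul (by positivity)]
        congr 1
        rw [hD]
        ring

section PartialD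

variable {n : ℕ} {φ : Rn n → ℂ}

theorem contDiff_partialD_iterate (hφ : ContDiff ℝ (⊤ : ℕ∞) φ) (i : Fin n) (l : ℕ) :
    ContDiff ℝ (⊤ : ℕ∞) ((partialD i)^[l] φ) := by
  induction l with
  | zero => exact hφ
  | succ l ih =>
    rw [Function.iterate_succ_apply']
    exact contDiff_partialD ih i

theorem partialD_iterate_eq_zero {ξ : Rn n} (h : φ =ᶠ[nhds ξ] 0) (i : Fin n) (l : ℕ) :
    (partialD i)^[l] φ ξ = 0 := by
  suffices (partialD i)^[l] φ =ᶠ[nhds ξ] 0 from this.eq_of_nhds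
  induction l with
  | zero => exact h
  | succ l ih =>
    rw [Function.iterate_succ_apply']
    have h2 := ih.fderiv (𝕜 := ℝ)
    filter_upwards [h2] with η hη
    change fderiv ℝ ((partialD i)^[l] φ) η _ = 0
    rw [hη, fderiv_zero]
    rfl

theorem partialD_iterate_comp_smul (hφ : ContDiff ℝ (⊤ : ℕ∞) φ) (i : Fin n) (t : ℝ) (l : ℕ) :
    (partialD i)^[l] (fun ξ => φ (t • ξ)) = fun ξ => t ^ l • (partialD i)^[l] φ (t • ξ) := by
  induction l with
  | zero => simp
  | succ l ih =>
    rw [Function.iterate_succ_apply', Function.iterate_succ_apply', ih]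
    ext ξ
    have h1 : HasFDerivAt ((partialD i)^[l] φ) (fderiv ℝ ((partialD i)^[l] φ) (t • ξ)) (t • ξ) :=
      ((contDiff_partialD_iterate hφ i l).differentiable (by simp) _).hasFDerivAt
    have h2 : HasFDerivAt (fun η : Rn n => t • η) (t • ContinuousLinearMap.id ℝ (Rn n)) ξ :=
      (hasFDerivAt_id ξ).const_smul t
    have h3 := (h1.comp ξ h2).const_smul (t ^ l)
    change fderiv ℝ _ ξ _ = _
    rw [HasFDerivAt.fderiv (f := fun ξ => t ^ l • (partialD i)^[l] φ (t • ξ)) h3]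
    simp [partialD, pow_succ, mul_assoc]

theorem exists_norm_partialD_iterate_le (hφ : ContDiff ℝ (⊤ : ℕ∞) φ) (hs : HasCompactSupport φ)
    (N : ℕ) : ∃ B : ℝ, 0 ≤ B ∧ ∀ i, ∀ l ≤ N, ∀ ξ, ‖(partialD i)^[l] φ ξ‖ ≤ B := by
  have h1 : ∀ i l, ∃ B : ℝ, ∀ ξ, ‖(partialD i)^[l] φ ξ‖ ≤ B := by
    intro i l
    refine (contDiff_partialD_iterate hφ i l).continuous.bounded_above_of_compact_support ?_
    refine HasCompactSupport.intro hs fun ξ hξ => ?_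
    exact partialD_iterate_eq_zero (notMem_tsupport_iff_eventuallyEq.1 hξ) i l
  choose B hB using h1
  have hB0 : ∀ i l, 0 ≤ B i l := fun i l => (norm_nonneg _).trans (hB i l 0)
  refine ⟨∑ i, ∑ l ∈ Finset.range (N + 1), B i l,
    Finset.sum_nonneg fun i _ => Finset.sum_nonneg fun l _ => hB0 i l, fun i l hl ξ => ?_⟩
  refine (hB i l ξ).trans ?_
  calc B i l ≤ ∑ l ∈ Finset.range (N + 1), B i l :=
        Finset.single_le_sum (fun l _ => hB0 i l) (by simpa using Nat.lt_succ_of_le hl)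
    _ ≤ _ := Finset.single_le_sum (f := fun i => ∑ l ∈ Finset.range (N + 1), B i l)
        (fun i _ => Finset.sum_nonneg fun l _ => hB0 i l) (Finset.mem_univ i)

end PartialD

section Dyadic

variable {n : ℕ}

/-- A smooth bump function on frequency space, equal to one on the unit ball. -/
def lowBump (n : ℕ) : ContDiffBump (0 : Rn n) := ⟨1, 2, one_pos, one_lt_two⟩

/-- The low frequency cutoff. -/
def lowCut (ξ : Rn n) : ℂ := (lowBump n ξ : ℝ)

/-- The cutoff to frequencies of size comparable to one. -/
def annulusCut (ξ : Rn n) : ℂ := lowCut ξ - lowCut ((2 : ℝ) • ξ)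

/-- The Littlewood-Paley partition of unity. -/
def dyadicCut : ℕ → Rn n → ℂ
  | 0 => lowCut
  | j + 1 => fun ξ => annulusCut (((2 : ℝ) ^ (j + 1))⁻¹ • ξ)

theorem contDiff_lowCut : ContDiff ℝ (⊤ : ℕ∞) (lowCut : Rn n → ℂ) :=
  Complex.ofRealCLM.contDiff.comp (lowBump n).contDiff

theorem lowCut_eq_one {ξ : Rn n} (h : ‖ξ‖ ≤ 1) : lowCut ξ = 1 := by
  rw [lowCut, (lowBump n).one_of_mem_closedBall (by simpa [lowBump] using h), Complex.ofReal_one]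

theorem lowCut_eq_zero {ξ : Rn n} (h : 2 ≤ ‖ξ‖) : lowCut ξ = 0 := by
  rw [lowCut, (lowBump n).zero_of_le_dist (by simpa [lowBump] using h), Complex.ofReal_zero]

theorem norm_lowCut_le (ξ : Rn n) : ‖lowCut ξ‖ ≤ 1 := by
  rw [lowCut, Complex.norm_real, Real.norm_of_nonneg (lowBump n).nonneg]
  exact (lowBump n).le_one

theorem contDiff_annulusCut : ContDiff ℝ (⊤ : ℕ∞) (annulusCut : Rn n → ℂ) :=
  contDiff_lowCut.sub (contDiff_lowCut.comp (contDiff_const_smul _))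

theorem annulusCut_eq_zero {ξ : Rn n} (h : ‖ξ‖ ≤ 1 / 2 ∨ 2 ≤ ‖ξ‖) : annulusCut ξ = 0 := by
  have h2 : ‖(2 : ℝ) • ξ‖ = 2 * ‖ξ‖ := by simp [norm_smul]
  rcases h with h | h
  · rw [annulusCut, lowCut_eq_one (by linarith), lowCut_eq_one (by rw [h2]; linarith), sub_self]
  · rw [annulusCut, lowCut_eq_zero h, lowCut_eq_zero (by rw [h2]; linarith), sub_self]

theorem hasCompactSupport_of_eq_zero {φ : Rn n → ℂ} (h : ∀ ξ, 2 ≤ ‖ξ‖ → φ ξ = 0) :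
    HasCompactSupport φ :=
  HasCompactSupport.intro (isCompact_closedBall 0 2) fun ξ hξ =>
    h ξ (by simpa using (not_le.1 (by simpa using hξ : ¬ ‖ξ‖ ≤ 2)).le)

theorem contDiff_dyadicCut (j : ℕ) : ContDiff ℝ (⊤ : ℕ∞) (dyadicCut j : Rn n → ℂ) := by
  cases j with
  | zero => exact contDiff_lowCut
  | succ j => exact contDiff_annulusCut.comp (contDiff_const_smul _)

theorem sum_dyadicCut (J : ℕ) (ξ : Rn n) :
    ∑ j ∈ Finset.range (J + 1), dyadicCut j ξ = lowCut (((2 : ℝ) ^ J)⁻¹ • ξ) := by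
  induction J with
  | zero => simp [dyadicCut]
  | succ J ih =>
    rw [Finset.sum_range_succ, ih]
    simp only [dyadicCut, annulusCut, smul_smul]
    have : (2 : ℝ) * (2 ^ (J + 1))⁻¹ = (2 ^ J)⁻¹ := by
      rw [pow_succ]
      field_simp
    rw [this]
    ring

theorem dyadicCut_eq_zero (j : ℕ) {ξ : Rn n} (h : 2 * 2 ^ j < ‖ξ‖) : dyadicCut j ξ = 0 := by
  cases j with
  | zero => exact lowCut_eq_zero (by linarith)
  | succ j =>
    refine annulusCut_eq_zero (Or.inr ?_)
    rw [norm_smul, norm_inv, norm_pow, Real.norm_ofNat, le_inv_mul_iff₀ (by positivity)]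
    linarith

theorem dyadicCut_bound (N : ℕ) : ∃ B : ℝ, 0 ≤ B ∧ ∀ j i, ∀ l ≤ N, ∀ ξ : Rn n,
    ‖(partialD i)^[l] (dyadicCut j) ξ‖ ≤ B * (((2 : ℝ) ^ j)⁻¹) ^ l := by
  obtain ⟨B, hB0, hB⟩ := exists_norm_partialD_iterate_le (contDiff_lowCut (n := n))
    (hasCompactSupport_of_eq_zero fun ξ h => lowCut_eq_zero h) N
  obtain ⟨B', hB0', hB'⟩ := exists_norm_partialD_iterate_le (contDiff_annulusCut (n := n))
    (hasCompactSupport_of_eq_zero fun ξ h => annulusCut_eq_zero (Or.inr h)) N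
  refine ⟨B + B', by positivity, fun j i l hl ξ => ?_⟩
  cases j with
  | zero =>
    simp only [pow_zero, inv_one, one_pow, mul_one]
    exact (hB i l hl ξ).trans (by linarith)
  | succ j =>
    change ‖(partialD i)^[l] (fun ξ => annulusCut (((2 : ℝ) ^ (j + 1))⁻¹ • ξ)) ξ‖ ≤ _
    rw [partialD_iterate_comp_smul contDiff_annulusCut, norm_smul, mul_comm]
    rw [Real.norm_of_nonneg (by positivity)]
    gcongr
    exact (hB' i l hl _).trans (by linarith)

theorem partialD_dyadicCut_eq_zero (j : ℕ) (i : Fin n) (l : ℕ) {ξ : Rn n}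
    (h : 1 + ‖ξ‖ ^ 2 < (2 ^ j) ^ 2 / 4 ∨ 5 * (2 ^ j) ^ 2 < 1 + ‖ξ‖ ^ 2) :
    (partialD i)^[l] (dyadicCut j) ξ = 0 := by
  refine partialD_iterate_eq_zero ?_ i l
  have hj : (1 : ℝ) ≤ 2 ^ j := one_le_pow₀ one_le_two
  rcases h with h | h
  · cases j with
    | zero => nlinarith [sq_nonneg ‖ξ‖]
    | succ j =>
      have h1 : ‖ξ‖ < 2 ^ (j + 1) / 2 := by
        refine lt_of_pow_lt_pow_left₀ 2 (by positivity) ?_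
        rw [div_pow]
        linarith
      have h2 : ∀ᶠ η : Rn n in nhds ξ, ‖η‖ < 2 ^ (j + 1) / 2 :=
        continuous_norm.continuousAt.eventually_lt continuousAt_const h1
      filter_upwards [h2] with η hη
      refine annulusCut_eq_zero (Or.inl ?_)
      rw [norm_smul, norm_inv, norm_pow, Real.norm_ofNat, inv_mul_le_iff₀ (by positivity)]
      linarith
  · have h1 : 2 * 2 ^ j < ‖ξ‖ := by
      refine lt_of_pow_lt_pow_left₀ 2 (by positivity) ?_
      rw [mul_pow]
      nlinarith
    have h2 : ∀ᶠ η : Rn n in nhds ξ, 2 * 2 ^ j < ‖η‖ :=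
      continuousAt_const.eventually_lt continuous_norm.continuousAt h1
    filter_upwards [h2] with η hη
    exact dyadicCut_eq_zero j hη

end Dyadic

theorem Real.rpow_le_five_rpow_abs {X : ℝ} (h1 : 1 / 4 ≤ X) (h2 : X ≤ 5) (t : ℝ) :
    X ^ t ≤ 5 ^ |t| := by
  rcases le_total 0 t with ht | ht
  · rw [abs_of_nonneg ht]
    exact Real.rpow_le_rpow (by linarith) h2 ht
  · rw [abs_of_nonpos ht]
    calc X ^ t ≤ (5⁻¹ : ℝ) ^ t :=
          Real.rpow_le_rpow_of_nonpos (by norm_num) (by norm_num at h1 ⊢; linarith) ht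
      _ = 5 ^ (-t) := by rw [Real.inv_rpow (by norm_num), Real.rpow_neg (by norm_num)]

theorem Real.rpow_div_two_le {X L : ℝ} (hL : 0 < L) (h1 : L ^ 2 / 4 ≤ X) (h2 : X ≤ 5 * L ^ 2)
    (s : ℝ) : X ^ (s / 2) ≤ 5 ^ |s / 2| * L ^ s := by
  have e : X = X / L ^ 2 * L ^ 2 := by field_simp
  have e2 : (L ^ 2) ^ (s / 2) = L ^ s := by
    rw [← Real.rpow_natCast, ← Real.rpow_mul hL.le]
    congr 1
    push_cast
    ring
  have hX : 0 ≤ X := le_trans (by positivity) h1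
  rw [e, Real.mul_rpow (by positivity) (by positivity), e2]
  gcongr
  refine Real.rpow_le_five_rpow_abs ?_ ?_ _
  · rw [le_div_iff₀ (by positivity)]
    linarith
  · rw [div_le_iff₀ (by positivity)]
    exact h2

section DyadicBound

variable {n : ℕ} {m ϱ δ δ' : ℝ} {a : Rn n → Rn n → ℂ}

theorem HormClass.exists_bound (ha : HormClass m ϱ δ a) (hδ : δ ≤ δ') (N : ℕ) :
    ∃ M : ℝ, 0 ≤ M ∧ ∀ L : ℝ, 1 ≤ L → ∀ z ξ : Rn n, L ^ 2 / 4 ≤ 1 + ‖ξ‖ ^ 2 →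
      1 + ‖ξ‖ ^ 2 ≤ 5 * L ^ 2 → ∀ k ≤ N, ∀ l ≤ N,
      ‖iteratedFDeriv ℝ l (fun y => iteratedFDeriv ℝ k (a y) ξ) z‖ ≤
        M * (L ^ m * (L ^ (-ϱ)) ^ k * (L ^ δ') ^ l) := by
  choose C hC0 hC using ha.2
  set D : ℕ → ℕ → ℝ := fun k l => C k l * 5 ^ |(m - ϱ * k + δ * l) / 2| with hD
  have hD0 : ∀ k l, 0 ≤ D k l := fun k l => by
    have := hC0 k l
    positivity
  refine ⟨∑ k ∈ Finset.range (N + 1), ∑ l ∈ Finset.range (N + 1), D k l,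
    Finset.sum_nonneg fun k _ => Finset.sum_nonneg fun l _ => hD0 k l, ?_⟩
  intro L hL z ξ h1 h2 k hk l hl
  have hLp : 0 < L := by linarith
  have hsum : D k l ≤ ∑ k ∈ Finset.range (N + 1), ∑ l ∈ Finset.range (N + 1), D k l :=
    (Finset.single_le_sum (f := fun l => D k l) (fun l _ => hD0 k l)
      (Finset.mem_range.2 (Nat.lt_succ_of_le hl))).trans
    (Finset.single_le_sum (f := fun k => ∑ l ∈ Finset.range (N + 1), D k l)
      (fun k _ => Finset.sum_nonneg fun l _ => hD0 k l)
      (Finset.mem_range.2 (Nat.lt_succ_of_le hk)))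
  have hexp : L ^ (m - ϱ * k + δ * l) ≤ L ^ m * (L ^ (-ϱ)) ^ k * (L ^ δ') ^ l := by
    rw [← Real.rpow_mul_natCast hLp.le, ← Real.rpow_mul_natCast hLp.le, ← Real.rpow_add hLp,
      ← Real.rpow_add hLp]
    refine Real.rpow_le_rpow_of_exponent_le hL ?_
    have := mul_le_mul_of_nonneg_right hδ (Nat.cast_nonneg (α := ℝ) l)
    linarith
  calc ‖iteratedFDeriv ℝ l (fun y => iteratedFDeriv ℝ k (a y) ξ) z‖
      ≤ C k l * (1 + ‖ξ‖ ^ 2) ^ ((m - ϱ * k + δ * l) / 2) := hC k l z ξ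
    _ ≤ C k l * (5 ^ |(m - ϱ * k + δ * l) / 2| * L ^ (m - ϱ * k + δ * l)) := by
        have := (hC0 k l).le
        gcongr
        exact Real.rpow_div_two_le hLp h1 h2 _
    _ = D k l * L ^ (m - ϱ * k + δ * l) := by rw [hD]; ring
    _ ≤ _ := mul_le_mul hsum hexp (by positivity) ((hD0 k l).trans hsum)

theorem HormClass.exists_dyadic_bound (ha : HormClass m ϱ δ a) (hδ : δ ≤ δ') (hϱ1 : ϱ ≤ 1)
    (N : ℕ) : ∃ M : ℝ, 0 ≤ M ∧ ∀ j : ℕ, ∀ w : List (Fin n), w.length ≤ N → ∀ k ≤ N, ∀ i z ξ,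
      ‖symDxWord w ((symDxi i)^[k] (symCut a (dyadicCut j))) z ξ‖ ≤
        M * (((2 : ℝ) ^ j) ^ m * (((2 : ℝ) ^ j) ^ (-ϱ)) ^ k * (((2 : ℝ) ^ j) ^ δ') ^ w.length) := by
  obtain ⟨M, hM0, hM⟩ := ha.exists_bound hδ N
  obtain ⟨B, hB0, hB⟩ := dyadicCut_bound (n := n) N
  have hsm : SymSmooth a := ha.1
  refine ⟨2 ^ N * (M * B), by positivity, fun j w hw k hk i z ξ => ?_⟩
  set L : ℝ := 2 ^ j with hL
  have hL1 : 1 ≤ L := one_le_pow₀ one_le_two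
  have hLp : 0 < L := by linarith
  by_cases hξ : 1 + ‖ξ‖ ^ 2 < L ^ 2 / 4 ∨ 5 * L ^ 2 < 1 + ‖ξ‖ ^ 2
  · refine (norm_symDxWord_symDxi_iterate_symCut_le w i z ξ 1 k a (dyadicCut j)
      (∑ l ∈ Finset.range (k + 1), ‖symDxWord w ((symDxi i)^[l] a) z ξ‖) 0
      (Finset.sum_nonneg fun _ _ => norm_nonneg _) hsm (contDiff_dyadicCut j)
      (fun l hl => ?_) (fun l hl => ?_) zero_le_one).trans ?_
    · rw [one_pow, mul_one]
      exact Finset.single_le_sum (f := fun l => ‖symDxWord w ((symDxi i)^[l] a) z ξ‖)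
        (fun _ _ => norm_nonneg _) (Finset.mem_range.2 (Nat.lt_succ_of_le hl))
    · rw [partialD_dyadicCut_eq_zero j i l hξ]
      simp
    · rw [mul_zero, zero_mul, mul_zero]
      positivity
  · rw [not_or, not_lt, not_lt] at hξ
    refine (norm_symDxWord_symDxi_iterate_symCut_le w i z ξ (L ^ (-ϱ)) k a (dyadicCut j)
      (M * (L ^ m * (L ^ δ') ^ w.length)) B (by positivity) hsm (contDiff_dyadicCut j)
      (fun l hl => ?_) (fun l hl => ?_) (by positivity)).trans ?_
    · refine (norm_symDxWord_symDxi_iterate_le hsm w i l z ξ).trans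
        ((hM L hL1 z ξ hξ.1 hξ.2 l (hl.trans hk) w.length hw).trans (le_of_eq ?_))
      ring
    · refine (hB j i l (hl.trans hk) ξ).trans ?_
      rw [← hL]
      gcongr
      rw [← Real.rpow_neg_one]
      exact Real.rpow_le_rpow_of_exponent_le hL1 (by linarith)
    · have : (2 : ℝ) ^ k ≤ 2 ^ N := pow_le_pow_right₀ one_le_two hk
      calc (2 : ℝ) ^ k * (M * (L ^ m * (L ^ δ') ^ w.length) * B * (L ^ (-ϱ)) ^ k)
          ≤ 2 ^ N * (M * (L ^ m * (L ^ δ') ^ w.length) * B * (L ^ (-ϱ)) ^ k) := by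
            gcongr
        _ = _ := by ring

theorem freqSupp_symCut_dyadicCut (a : Rn n → Rn n → ℂ) (j : ℕ) :
    FreqSupp (2 * 2 ^ j) (symCut a (dyadicCut j)) := fun z ξ h => by
  rw [symCut, dyadicCut_eq_zero j h, mul_zero]

theorem HormClass.exists_lintegral_symKer_le (hn : 1 ≤ n) (ha : HormClass m ϱ δ a)
    (hδ : δ ≤ δ') (hϱ : ϱ ≤ δ') (hϱ1 : ϱ ≤ 1) :
    ∃ C : ℝ, 0 ≤ C ∧ ∀ (j : ℕ) (y : Rn n),
      ∫⁻ x, ‖symKer (symCut a (dyadicCut j)) x (x - y)‖ₑ ≤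
        ENNReal.ofReal (C * ((2 : ℝ) ^ (m + n / 2 * (1 - ϱ) + n / 2 * (δ' - ϱ))) ^ j) := by
  obtain ⟨M, hM0, hM⟩ := ha.exists_dyadic_bound hδ hϱ1 (n + 1)
  have hk0 : 0 ≤ kerConst n := by
    have : 0 ≤ ∫ v : Rn n, decayWeight 1 v :=
      integral_nonneg fun v => by unfold decayWeight; positivity
    unfold kerConst
    positivity
  refine ⟨2 ^ n * n ^ (n + 1) * ((1 + n) * kerConst n) * (M * √(2 ^ n)), by positivity,
    fun j y => ?_⟩
  set L : ℝ := 2 ^ j with hL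
  have hL1 : 1 ≤ L := one_le_pow₀ one_le_two
  have hLp : 0 < L := by linarith
  have hr : ∀ w : List (Fin n), (L ^ (-δ')) ^ w.length * (L ^ δ') ^ w.length = 1 := fun w => by
    rw [← mul_pow, ← Real.rpow_add hLp, neg_add_cancel, Real.rpow_zero, one_pow]
  have hR : ∀ k : ℕ, (L ^ ϱ) ^ k * (L ^ (-ϱ)) ^ k = 1 := fun k => by
    rw [← mul_pow, ← Real.rpow_add hLp, add_neg_cancel, Real.rpow_zero, one_pow]
  have hscaled : ∀ w : List (Fin n), w.length ≤ n → ∀ k ≤ n + 1, ∀ i z ξ,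
      (L ^ (-δ')) ^ w.length * ((L ^ ϱ) ^ k *
        ‖symDxWord w ((symDxi i)^[k] (symCut a (dyadicCut j))) z ξ‖) ≤ M * L ^ m := by
    intro w hw k hk i z ξ
    have h1 := hM j w (by omega) k hk i z ξ
    rw [← hL] at h1
    calc _ ≤ (L ^ (-δ')) ^ w.length * ((L ^ ϱ) ^ k *
          (M * (L ^ m * (L ^ (-ϱ)) ^ k * (L ^ δ') ^ w.length))) := by gcongr
      _ = ((L ^ (-δ')) ^ w.length * (L ^ δ') ^ w.length) * ((L ^ ϱ) ^ k * (L ^ (-ϱ)) ^ k) *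
          (M * L ^ m) := by ring
      _ = M * L ^ m := by rw [hr, hR, one_mul, one_mul]
  have hsm : SymSmooth a := ha.1
  refine (lintegral_enorm_symKer_le hn (r := L ^ (-δ')) (R := L ^ ϱ) (ρ := 2 * L) (A := M * L ^ m)
    (by positivity) (by positivity) ?_ (by positivity) (hsm.symCut (contDiff_dyadicCut j))
    (freqSupp_symCut_dyadicCut a j) (fun w hw z ξ => ?_)
    (fun w hw i z ξ => hscaled w hw (n + 1) le_rfl i z ξ) y).trans (le_of_eq ?_)
  · rw [← Real.rpow_add hLp]
    exact Real.rpow_le_one_of_one_le_of_nonpos hL1 (by linarith)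
  · simpa using hscaled w hw 0 (by omega) ⟨0, hn⟩ z ξ
  · congr 1
    have hsq : ∀ t : ℝ, √((L ^ t) ^ n) = L ^ (t * n / 2) := fun t => by
      rw [← Real.rpow_mul_natCast hLp.le, Real.sqrt_eq_rpow, ← Real.rpow_mul hLp.le]
      ring_nf
    have e1 : √((2 * L) ^ n) = √(2 ^ n) * L ^ ((n : ℝ) / 2) := by
      have := hsq 1
      rw [Real.rpow_one, one_mul] at this
      rw [mul_pow, Real.sqrt_mul (by positivity), this]
    have e2 : ((2 : ℝ) ^ (m + n / 2 * (1 - ϱ) + n / 2 * (δ' - ϱ))) ^ j =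
        L ^ m * (L ^ ((n : ℝ) / 2) / (L ^ (-δ' * n / 2) * (L ^ ϱ) ^ n)) := by
      rw [← Real.rpow_mul_natCast hLp.le, ← Real.rpow_add hLp, ← Real.rpow_sub hLp,
        ← Real.rpow_add hLp, hL, ← Real.rpow_natCast_mul (by norm_num),
        ← Real.rpow_mul_natCast (by norm_num)]
      congr 1
      ring
    rw [e1, e2, hsq]
    ring

end DyadicBound

section Assembly

variable {n : ℕ}

theorem integrable_ft (u : SchwartzMap (Rn n) ℂ) : Integrable (ft u) := by
  have h : ∀ ξ, ft u ξ = FourierTransform.fourier u (((2 * π)⁻¹ : ℝ) • ξ) := by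
    intro ξ
    rw [SchwartzMap.fourier_coe, Real.fourier_eq', ft]
    congr 1
    ext v
    rw [smul_eq_mul, real_inner_smul_right, ← mul_neg, mul_comm Complex.I, ← Complex.ofReal_neg]
    congr 4
    field_simp
  rw [funext h]
  exact (FourierTransform.fourier u).integrable.comp_smul (by positivity)

theorem pdo_eq_integral_symKer {b : Rn n → Rn n → ℂ} {ρ : ℝ} (hb : SymSmooth b)
    (h : FreqSupp ρ b) (u : SchwartzMap (Rn n) ℂ) (x : Rn n) :
    pdo b u x = ∫ y, symKer b x (x - y) * u y := by
  have hbi : Integrable (b x) :=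
    (hb.right x).continuous.integrable_of_hasCompactSupport (h.hasCompactSupport x)
  have hprod : Integrable (fun p : Rn n × Rn n =>
      Complex.exp (Complex.I * ((⟪x - p.2, p.1⟫_ℝ : ℝ) : ℂ)) * (b x p.1 * u p.2))
      (volume.prod volume) := by
    refine (hbi.mul_prod u.integrable).bdd_mul (c := 1) ?_ (Filter.Eventually.of_forall fun p => ?_)
    · refine (Complex.continuous_exp.comp (continuous_const.mul
        (Complex.continuous_ofReal.comp ?_))).aestronglyMeasurable
      exact Continuous.inner (by fun_prop) (by fun_prop)
    · rw [Complex.norm_exp_I_mul_ofReal]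
  calc pdo b u x
      = ∫ ξ, ∫ y, Complex.exp (Complex.I * ((⟪x - y, ξ⟫_ℝ : ℝ) : ℂ)) * (b x ξ * u y) := by
        rw [pdo]
        congr 1
        ext ξ
        rw [ft, ← integral_const_mul]
        congr 1
        ext y
        rw [inner_sub_left, Complex.ofReal_sub, mul_sub, Complex.exp_sub, Complex.exp_neg]
        ring
    _ = ∫ y, ∫ ξ, Complex.exp (Complex.I * ((⟪x - y, ξ⟫_ℝ : ℝ) : ℂ)) * (b x ξ * u y) :=
        integral_integral_swap hprod
    _ = _ := by
        congr 1
        ext y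
        rw [symKer, ← integral_mul_const]
        simp_rw [mul_assoc]

theorem tendsto_sum_pdo_symCut_dyadicCut {a : Rn n → Rn n → ℂ} (hsm : SymSmooth a) {M : ℝ}
    (x : Rn n) (hM : ∀ ξ, ‖a x ξ‖ ≤ M) (u : SchwartzMap (Rn n) ℂ) :
    Filter.Tendsto (fun J => ∑ j ∈ Finset.range (J + 1), pdo (symCut a (dyadicCut j)) u x)
      Filter.atTop (nhds (pdo a u x)) := by
  have hint : ∀ j, Integrable fun ξ => Complex.exp (Complex.I * ((⟪x, ξ⟫_ℝ : ℝ) : ℂ)) *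
      symCut a (dyadicCut j) x ξ * ft u ξ := by
    intro j
    have hs := hsm.symCut (contDiff_dyadicCut j)
    obtain ⟨B, hB⟩ := (hs.right x).continuous.bounded_above_of_compact_support
      ((freqSupp_symCut_dyadicCut a j).hasCompactSupport x)
    refine (integrable_ft u).bdd_mul (c := B)
      ((continuous_osc x).mul (hs.right x).continuous).aestronglyMeasurable
      (Filter.Eventually.of_forall fun ξ => ?_)
    rw [norm_mul, Complex.norm_exp_I_mul_ofReal, one_mul]
    exact hB ξ
  have hsum : ∀ J, ∑ j ∈ Finset.range (J + 1), pdo (symCut a (dyadicCut j)) u x =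
      ∫ ξ, Complex.exp (Complex.I * ((⟪x, ξ⟫_ℝ : ℝ) : ℂ)) *
        (a x ξ * lowCut (((2 : ℝ) ^ J)⁻¹ • ξ)) * ft u ξ := by
    intro J
    simp only [pdo]
    rw [← integral_finsetSum _ fun j _ => hint j]
    congr 1
    ext ξ
    have hcut : a x ξ * ∑ j ∈ Finset.range (J + 1), dyadicCut j ξ =
        ∑ j ∈ Finset.range (J + 1), symCut a (dyadicCut j) x ξ := Finset.mul_sum _ _ _
    rw [← Finset.sum_mul, ← Finset.mul_sum, ← sum_dyadicCut, hcut]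
  simp_rw [hsum]
  refine tendsto_integral_of_dominated_convergence (fun ξ => M * ‖ft u ξ‖) (fun J => ?_)
    ((integrable_ft u).norm.const_mul M) (fun J => Filter.Eventually.of_forall fun ξ => ?_)
    (Filter.Eventually.of_forall fun ξ => ?_)
  · refine AEStronglyMeasurable.mul ?_ (integrable_ft u).aestronglyMeasurable
    exact ((continuous_osc x).mul ((hsm.right x).continuous.mul
      (contDiff_lowCut.continuous.comp (continuous_const_smul _)))).aestronglyMeasurable
  · rw [norm_mul, norm_mul, Complex.norm_exp_I_mul_ofReal, one_mul, norm_mul]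
    gcongr
    calc ‖a x ξ‖ * ‖lowCut (((2 : ℝ) ^ J)⁻¹ • ξ)‖ ≤ ‖a x ξ‖ * 1 := by
          gcongr
          exact norm_lowCut_le _
      _ ≤ M := by rw [mul_one]; exact hM ξ
  · refine tendsto_const_nhds.congr' ?_
    have h2 := (tendsto_pow_atTop_atTop_of_one_lt (one_lt_two (α := ℝ))).eventually_ge_atTop ‖ξ‖
    filter_upwards [h2] with J hJ
    rw [lowCut_eq_one, mul_one]
    rw [norm_smul, norm_inv, norm_pow, Real.norm_ofNat, inv_mul_le_iff₀ (by positivity), mul_one]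
    exact hJ

theorem HormClass.exists_norm_le {m ϱ δ : ℝ} {a : Rn n → Rn n → ℂ} (ha : HormClass m ϱ δ a)
    (hm : m ≤ 0) : ∃ M, ∀ x ξ, ‖a x ξ‖ ≤ M := by
  obtain ⟨C, hC0, hC⟩ := ha.2 0 0
  refine ⟨C, fun x ξ => ?_⟩
  have h := hC x ξ
  simp only [norm_iteratedFDeriv_zero, Nat.cast_zero, mul_zero, sub_zero, add_zero] at h
  refine h.trans (mul_le_of_le_one_right hC0.le ?_)
  exact Real.rpow_le_one_of_one_le_of_nonpos (by nlinarith [sq_nonneg ‖ξ‖]) (by linarith)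

theorem lintegral_enorm_pdo_le {a : Rn n → Rn n → ℂ} (hsm : SymSmooth a) {M C q : ℝ}
    (hM : ∀ x ξ, ‖a x ξ‖ ≤ M) (hC : 0 ≤ C) (hq0 : 0 ≤ q) (hq1 : q < 1)
    (hker : ∀ (j : ℕ) (y : Rn n), ∫⁻ x, ‖symKer (symCut a (dyadicCut j)) x (x - y)‖ₑ ≤
      ENNReal.ofReal (C * q ^ j)) (u : SchwartzMap (Rn n) ℂ) :
    ∫⁻ x, ‖pdo a u x‖ₑ ≤ ENNReal.ofReal (C * (1 - q)⁻¹) * ∫⁻ x, ‖u x‖ₑ := by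
  set g : ℕ → Rn n → ℝ≥0∞ := fun j x =>
    ∫⁻ y, ‖symKer (symCut a (dyadicCut j)) x (x - y)‖ₑ * ‖u y‖ₑ with hg
  have hs : ∀ j, SymSmooth (symCut a (dyadicCut j)) := fun j => hsm.symCut (contDiff_dyadicCut j)
  have hmeas : ∀ j, Measurable fun p : Rn n × Rn n =>
      ‖symKer (symCut a (dyadicCut j)) p.1 (p.1 - p.2)‖ₑ * ‖u p.2‖ₑ := by
    intro j
    have hk : Measurable fun p : Rn n × Rn n =>
        ‖symKer (symCut a (dyadicCut j)) p.1 (p.1 - p.2)‖ₑ :=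
      ((continuous_symKer (hs j) (freqSupp_symCut_dyadicCut a j)).comp
        (f := fun p : Rn n × Rn n => (p.1, p.1 - p.2)) (by fun_prop)).measurable.enorm
    have hu : Measurable fun p : Rn n × Rn n => ‖u p.2‖ₑ :=
      (u.continuous.comp continuous_snd).measurable.enorm
    exact hk.mul hu
  have hpt : ∀ x, ‖pdo a u x‖ₑ ≤ ∑' j, g j x := by
    intro x
    refine le_of_tendsto' (tendsto_sum_pdo_symCut_dyadicCut hsm x (hM x) u).enorm fun J => ?_
    refine (enorm_sum_le _ _).trans ((Finset.sum_le_sum fun j _ => ?_).trans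
      (ENNReal.sum_le_tsum (Finset.range (J + 1))))
    rw [pdo_eq_integral_symKer (hs j) (freqSupp_symCut_dyadicCut a j)]
    refine (enorm_integral_le_lintegral_enorm _).trans (le_of_eq ?_)
    simp_rw [enorm_mul]
    rfl
  have hgj : ∀ j, ∫⁻ x, g j x ≤ ENNReal.ofReal (C * q ^ j) * ∫⁻ y, ‖u y‖ₑ := by
    intro j
    calc ∫⁻ x, g j x
        = ∫⁻ y, ∫⁻ x, ‖symKer (symCut a (dyadicCut j)) x (x - y)‖ₑ * ‖u y‖ₑ :=
          lintegral_lintegral_swap (hmeas j).aemeasurable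
      _ ≤ ∫⁻ y, ENNReal.ofReal (C * q ^ j) * ‖u y‖ₑ := by
          refine lintegral_mono fun y => ?_
          rw [lintegral_mul_const' _ _ enorm_ne_top]
          gcongr
          exact hker j y
      _ = _ := lintegral_const_mul _ u.continuous.measurable.enorm
  calc ∫⁻ x, ‖pdo a u x‖ₑ ≤ ∫⁻ x, ∑' j, g j x := lintegral_mono hpt
    _ = ∑' j, ∫⁻ x, g j x :=
        lintegral_tsum fun j => (hmeas j).lintegral_prod_right'.aemeasurable
    _ ≤ ∑' j, ENNReal.ofReal (C * q ^ j) * ∫⁻ y, ‖u y‖ₑ := ENNReal.tsum_le_tsum hgj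
    _ = _ := by
        rw [ENNReal.tsum_mul_right, ← ENNReal.ofReal_tsum_of_nonneg
          (fun j => by positivity) ((summable_geometric_of_lt_one hq0 hq1).mul_left C),
          tsum_mul_left, tsum_geometric_of_lt_one hq0 hq1]

end Assembly

/-- If `a ∈ S^m_{ϱ,δ}` with `0 ≤ ϱ ≤ 1`, `0 ≤ δ < 1` and
`m < -(n/2)(1-ϱ) - (n/2) max{δ-ϱ, 0}`, then `‖T_a u‖_{L¹} ≤ C ‖u‖_{L¹}` for Schwartz `u`. -/
theorem stmt6 (n : ℕ) (hn : 1 ≤ n) (ϱ δ m : ℝ)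
    (hϱ0 : 0 ≤ ϱ) (hϱ1 : ϱ ≤ 1) (hδ0 : 0 ≤ δ) (hδ1 : δ < 1)
    (hm : m < -((n : ℝ) / 2) * (1 - ϱ) - ((n : ℝ) / 2) * max (δ - ϱ) 0)
    (a : Rn n → Rn n → ℂ) (ha : HormClass m ϱ δ a) :
    ∃ C : ℝ, 0 < C ∧ ∀ u : SchwartzMap (Rn n) ℂ,
      (∫⁻ x : Rn n, (‖pdo a (⇑u) x‖₊ : ℝ≥0∞)) ≤
        ENNReal.ofReal C * ∫⁻ x : Rn n, (‖u x‖₊ : ℝ≥0∞) := by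
  have hmax : max (δ - ϱ) 0 = max δ ϱ - ϱ := by rw [← max_sub_sub_right, sub_self]
  rw [hmax] at hm
  have hn0 : (0 : ℝ) ≤ n / 2 := by positivity
  have h1 : 0 ≤ (n : ℝ) / 2 * (1 - ϱ) := mul_nonneg hn0 (by linarith)
  have h2 : 0 ≤ (n : ℝ) / 2 * (max δ ϱ - ϱ) :=
    mul_nonneg hn0 (by linarith [le_max_right δ ϱ])
  obtain ⟨M, hM⟩ := ha.exists_norm_le (by linarith)
  obtain ⟨C, hC0, hC⟩ := ha.exists_lintegral_symKer_le hn (le_max_left δ ϱ) (le_max_right δ ϱ) hϱ1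
  set q : ℝ := (2 : ℝ) ^ (m + n / 2 * (1 - ϱ) + n / 2 * (max δ ϱ - ϱ)) with hq
  have hq1 : q < 1 := Real.rpow_lt_one_of_one_lt_of_neg one_lt_two (by linarith)
  have hq0 : 0 ≤ q := by positivity
  have hq2 : 0 ≤ (1 - q)⁻¹ := inv_nonneg.2 (by linarith)
  refine ⟨C * (1 - q)⁻¹ + 1, by positivity, fun u => ?_⟩
  refine (lintegral_enorm_pdo_le ha.1 hM hC0 hq0 hq1 hC u).trans ?_
  refine mul_le_mul_left (ENNReal.ofReal_le_ofReal (by linarith)) _
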